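/- arXiv:2404.19569 — 4 statements merged into one kernel-verified Lean document; each statement's English description precedes it below -/
import Mathlib

section
/- Let m ≥ 1, let Γ be a symmetric positive definite m×m real matrix, and let A : ℝ → ℝ^{m×m} be a continuous family of symmetric positive semidefinite matrices such that ‖A(t)‖ ≤ r for all t ≥ 0 for some constant r > 0, and suppose there exist T > 0 and ι > 0 such that ι·I_m ⪯ ∫_{t−T}^{t} A(s) ds for all t ≥ T. Then there exist constants κ > 0 and γ > 0 such that every differentiable x : [0,∞) → ℝ^m satisfying x'(t) = −Γ A(t) x(t) for all t ≥ 0 obeys ‖x(t)‖ ≤ κ e^{−γ t} ‖x(0)‖ for all t ≥ 0 (global exponential stability of the origin). -/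
open Set MeasureTheory intervalIntegral RealInnerProductSpace

section PersistencyOfExcitation

variable {E : Type*} [NormedAddCommGroup E] [InnerProductSpace ℝ E]

/-- A symmetric positive semidefinite operator satisfies `‖B v‖² ≤ ‖B‖ ⟪v, B v⟫`. -/
lemma norm_apply_sq_le_of_symm_of_nonneg (B : E →L[ℝ] E)
    (hsymm : ∀ v w, ⟪B v, w⟫ = ⟪v, B w⟫) (hpos : ∀ v, 0 ≤ ⟪v, B v⟫) (v : E) :
    ‖B v‖ ^ 2 ≤ ‖B‖ * ⟪v, B v⟫ := by
  have hquad : ∀ t : ℝ, 0 ≤ ⟪B v, B (B v)⟫ * (t * t) + (2 * ‖B v‖ ^ 2) * t + ⟪v, B v⟫ := by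
    intro t
    have h := hpos (v + t • B v)
    have e : ⟪v, B (B v)⟫ = ‖B v‖ ^ 2 := by rw [← hsymm, real_inner_self_eq_norm_sq]
    simp only [map_add, map_smul, inner_add_left, inner_add_right, real_inner_smul_left,
      real_inner_smul_right, e, real_inner_self_eq_norm_sq] at h
    linarith
  have hdisc := discrim_le_zero hquad
  have hle : ⟪B v, B (B v)⟫ ≤ ‖B‖ * ‖B v‖ ^ 2 := by
    calc ⟪B v, B (B v)⟫ ≤ ‖B v‖ * ‖B (B v)‖ := real_inner_le_norm _ _
      _ ≤ ‖B v‖ * (‖B‖ * ‖B v‖) := by gcongr; exact B.le_opNorm _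
      _ = ‖B‖ * ‖B v‖ ^ 2 := by ring
  rw [discrim] at hdisc
  rcases (sq_nonneg ‖B v‖).eq_or_lt with h0 | h0
  · rw [← h0]
    exact mul_nonneg (norm_nonneg _) (hpos v)
  · have := mul_le_mul_of_nonneg_right hle (hpos v)
    refine le_of_mul_le_mul_right ?_ h0
    nlinarith

lemma inner_apply_le_two_mul_add {B : E →L[ℝ] E}
    (hsymm : ∀ v w, ⟪B v, w⟫ = ⟪v, B w⟫) (hpos : ∀ v, 0 ≤ ⟪v, B v⟫) (v w : E) :
    ⟪v, B v⟫ ≤ 2 * ⟪w, B w⟫ + 2 * ⟪w - v, B (w - v)⟫ := by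
  have h := hpos (w + (w - v))
  have e : ⟪w, B v⟫ = ⟪v, B w⟫ := by rw [← hsymm, real_inner_comm]
  simp only [map_add, map_sub, inner_add_left, inner_add_right, inner_sub_left,
    inner_sub_right, e] at h ⊢
  linarith

lemma sq_le_mul_of_forall_le_add {y α β : ℝ} (hy : 0 ≤ y) (hα : 0 < α) (hβ : 0 ≤ β)
    (h : ∀ ε > 0, y ≤ ε * α / 2 + β / (2 * ε)) : y ^ 2 ≤ α * β := by
  rcases hy.eq_or_lt with rfl | hy
  · simpa using mul_nonneg hα.le hβ
  · have h1 := h (y / α) (div_pos hy hα)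
    have h2 : y / α * α / 2 + β / (2 * (y / α)) = y / 2 + α * β / (2 * y) := by
      field_simp
    rw [h2] at h1
    have h3 : y / 2 ≤ α * β / (2 * y) := by linarith
    rw [le_div_iff₀ (by positivity)] at h3
    nlinarith

variable {Γ P : E →L[ℝ] E} {A : ℝ → E →L[ℝ] E} {x : ℝ → E}

lemma hasDerivWithinAt_inner_gradientFlow
    (hΓsymm : ∀ v w, ⟪Γ v, w⟫ = ⟪v, Γ w⟫) (hPΓ : ∀ v, P (Γ v) = v) (hΓP : ∀ v, Γ (P v) = v)
    {t : ℝ} {s : Set ℝ} (hx : HasDerivWithinAt x (-(Γ (A t (x t)))) s t) :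
    HasDerivWithinAt (fun t => ⟪x t, P (x t)⟫) (-(2 * ⟪x t, A t (x t)⟫)) s t := by
  have hP := P.hasFDerivAt.comp_hasDerivWithinAt t hx
  refine (hx.inner ℝ hP).congr_deriv ?_
  simp only [Function.comp, map_neg, hPΓ, inner_neg_left, inner_neg_right, hΓsymm, hΓP]
  rw [real_inner_comm (x t)]
  ring

variable {r a b : ℝ}

/-- The displacement of the flow is controlled by the dissipated energy. -/
lemma norm_sub_sq_le_gradientFlow
    (hΓsymm : ∀ v w, ⟪Γ v, w⟫ = ⟪v, Γ w⟫) (hPΓ : ∀ v, P (Γ v) = v) (hΓP : ∀ v, Γ (P v) = v)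
    (hAsymm : ∀ t v w, ⟪A t v, w⟫ = ⟪v, A t w⟫) (hApsd : ∀ t v, 0 ≤ ⟪v, A t v⟫)
    (hAbd : ∀ t ∈ Icc a b, ‖A t‖ ≤ r)
    (hx : ∀ t ∈ Icc a b, HasDerivWithinAt x (-(Γ (A t (x t)))) (Ici t) t)
    (hxc : ContinuousOn x (Icc a b)) (hab : a < b)
    (hV : AntitoneOn (fun t => ⟪x t, P (x t)⟫) (Icc a b)) {s : ℝ} (hs : s ∈ Icc a b) :
    ‖x s - x a‖ ^ 2 ≤
      (b - a) * (‖Γ‖ ^ 2 * r * ((⟪x a, P (x a)⟫ - ⟪x b, P (x b)⟫) / 2)) := by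
  have ha : a ∈ Icc a b := left_mem_Icc.2 hab.le
  have hr : 0 ≤ r := (norm_nonneg _).trans (hAbd a ha)
  have hVs : ∀ t ∈ Icc a b, ⟪x b, P (x b)⟫ ≤ ⟪x t, P (x t)⟫ := fun t ht =>
    hV ht (right_mem_Icc.2 hab.le) ht.2
  have hc : 0 ≤ ‖Γ‖ ^ 2 * r := by positivity
  refine sq_le_mul_of_forall_le_add (norm_nonneg _) (sub_pos.2 hab)
    (mul_nonneg hc (by linarith [hVs a ha])) fun ε hε => ?_
  have key : ‖x s - x a‖ ≤ ε * (s - a) / 2 +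
      ‖Γ‖ ^ 2 * r * ((⟪x a, P (x a)⟫ - ⟪x s, P (x s)⟫) / 2) / (2 * ε) := by
    refine image_norm_le_of_norm_deriv_right_le_deriv_boundary'
      (f := fun s => x s - x a) (f' := fun t => -(Γ (A t (x t))))
      (B := fun s => ε * (s - a) / 2 +
        ‖Γ‖ ^ 2 * r * ((⟪x a, P (x a)⟫ - ⟪x s, P (x s)⟫) / 2) / (2 * ε))
      (B' := fun t => ε / 2 + ‖Γ‖ ^ 2 * r * ⟪x t, A t (x t)⟫ / (2 * ε))
      (hxc.sub continuousOn_const) (fun t ht => (hx t (Ico_subset_Icc_self ht)).sub_const _)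
      (by simp) ?_ ?_ ?_ hs
    · have : ContinuousOn (fun t => ⟪x t, P (x t)⟫) (Icc a b) :=
        hxc.inner (P.continuous.comp_continuousOn hxc)
      fun_prop
    · intro t ht
      have h1 := hasDerivWithinAt_inner_gradientFlow hΓsymm hPΓ hΓP (hx t (Ico_subset_Icc_self ht))
      have h2 := ((((h1.const_sub ⟪x a, P (x a)⟫).div_const 2).const_mul
        (‖Γ‖ ^ 2 * r)).div_const (2 * ε))
      have h3 := ((((hasDerivWithinAt_id t (Ici t)).sub_const a).const_mul ε).div_const 2)
      refine (h3.add h2).congr_deriv ?_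
      ring
    · intro t ht
      have h1 : ‖A t (x t)‖ ^ 2 ≤ r * ⟪x t, A t (x t)⟫ :=
        (norm_apply_sq_le_of_symm_of_nonneg (A t) (hAsymm t) (hApsd t) (x t)).trans
          (mul_le_mul_of_nonneg_right (hAbd t (Ico_subset_Icc_self ht)) (hApsd t _))
      have h2 : ‖Γ (A t (x t))‖ ^ 2 ≤ ‖Γ‖ ^ 2 * r * ⟪x t, A t (x t)⟫ := by
        calc ‖Γ (A t (x t))‖ ^ 2 ≤ (‖Γ‖ * ‖A t (x t)‖) ^ 2 := by gcongr; exact Γ.le_opNorm _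
          _ = ‖Γ‖ ^ 2 * ‖A t (x t)‖ ^ 2 := by ring
          _ ≤ ‖Γ‖ ^ 2 * (r * ⟪x t, A t (x t)⟫) := by gcongr
          _ = _ := by ring
      rw [norm_neg]
      have h3 : ‖Γ (A t (x t))‖ ≤ ε / 2 + ‖Γ (A t (x t))‖ ^ 2 / (2 * ε) := by
        have : ε / 2 + ‖Γ (A t (x t))‖ ^ 2 / (2 * ε) - ‖Γ (A t (x t))‖
            = (ε - ‖Γ (A t (x t))‖) ^ 2 / (2 * ε) := by field_simp; ring
        have : 0 ≤ (ε - ‖Γ (A t (x t))‖) ^ 2 / (2 * ε) := by positivity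
        linarith
      refine h3.trans ?_
      gcongr
  refine key.trans ?_
  have := hVs s hs
  have := hs.2
  gcongr

/-- One excitation window dissipates a fixed fraction of the energy. -/
lemma norm_sq_le_energy_drop
    (hΓsymm : ∀ v w, ⟪Γ v, w⟫ = ⟪v, Γ w⟫) (hPΓ : ∀ v, P (Γ v) = v) (hΓP : ∀ v, Γ (P v) = v)
    (hAcont : ContinuousOn A (Icc a b))
    (hAsymm : ∀ t v w, ⟪A t v, w⟫ = ⟪v, A t w⟫) (hApsd : ∀ t v, 0 ≤ ⟪v, A t v⟫)
    (hAbd : ∀ t ∈ Icc a b, ‖A t‖ ≤ r)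
    (hx : ∀ t ∈ Icc a b, HasDerivWithinAt x (-(Γ (A t (x t)))) (Ici t) t)
    (hxc : ContinuousOn x (Icc a b)) (hab : a < b)
    (hV : AntitoneOn (fun t => ⟪x t, P (x t)⟫) (Icc a b)) {ι : ℝ}
    (hPE : ι * ‖x a‖ ^ 2 ≤ ∫ s in a..b, ⟪x a, A s (x a)⟫) :
    ι * ‖x a‖ ^ 2 ≤
      (1 + (b - a) ^ 2 * ‖Γ‖ ^ 2 * r ^ 2) * (⟪x a, P (x a)⟫ - ⟪x b, P (x b)⟫) := by
  set D := ⟪x a, P (x a)⟫ - ⟪x b, P (x b)⟫ with hD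
  set M := (b - a) * (‖Γ‖ ^ 2 * r * (D / 2)) with hM
  have hr : 0 ≤ r := (norm_nonneg _).trans (hAbd a (left_mem_Icc.2 hab.le))
  have hEc : ContinuousOn (fun s => 2 * ⟪x s, A s (x s)⟫) (Icc a b) :=
    continuousOn_const.mul (hxc.inner (hAcont.clm_apply hxc))
  have hEi : IntervalIntegrable (fun s => 2 * ⟪x s, A s (x s)⟫) volume a b :=
    hEc.intervalIntegrable_of_Icc hab.le
  have hFc : ContinuousOn (fun s => ⟪x a, A s (x a)⟫) (Icc a b) :=
    continuousOn_const.inner (hAcont.clm_apply continuousOn_const)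
  have hint : ∫ s in a..b, 2 * ⟪x s, A s (x s)⟫ = D := by
    have h := integral_eq_sub_of_hasDeriv_right_of_le hab.le
      (f := fun t => -⟪x t, P (x t)⟫) (f' := fun s => 2 * ⟪x s, A s (x s)⟫)
      (hxc.inner (P.continuous.comp_continuousOn hxc)).neg
      (fun t ht => by
        have h1 := (hasDerivWithinAt_inner_gradientFlow hΓsymm hPΓ hΓP
          (hx t (Ioo_subset_Icc_self ht))).neg.mono (Ioi_subset_Ici_self)
        rwa [neg_neg] at h1) hEi
    rw [h, hD]
    ring
  have hle : ∫ s in a..b, ⟪x a, A s (x a)⟫ ≤ ∫ s in a..b, (2 * ⟪x s, A s (x s)⟫ + 2 * (r * M)) := by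
    refine integral_mono_on hab.le (hFc.intervalIntegrable_of_Icc hab.le)
      (hEi.add intervalIntegrable_const) fun s hs => ?_
    have h1 := inner_apply_le_two_mul_add (hAsymm s) (hApsd s) (x a) (x s)
    have h2 : ⟪x s - x a, A s (x s - x a)⟫ ≤ r * M := by
      calc ⟪x s - x a, A s (x s - x a)⟫ ≤ ‖x s - x a‖ * ‖A s (x s - x a)‖ := real_inner_le_norm _ _
        _ ≤ ‖x s - x a‖ * (r * ‖x s - x a‖) := by
            gcongr
            exact (A s).le_of_opNorm_le (hAbd s hs) _
        _ = r * ‖x s - x a‖ ^ 2 := by ring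
        _ ≤ r * M := by
            gcongr
            exact norm_sub_sq_le_gradientFlow hΓsymm hPΓ hΓP hAsymm hApsd hAbd hx hxc hab hV hs
    linarith
  rw [integral_add hEi intervalIntegrable_const, hint, intervalIntegral.integral_const, smul_eq_mul] at hle
  refine (hPE.trans hle).trans_eq ?_
  rw [hM]
  ring

end PersistencyOfExcitation

/-- A nonincreasing function contracted by a fixed factor over each window of length `T`
decays exponentially. -/
lemma le_exp_of_antitoneOn_of_contraction {V : ℝ → ℝ} {T δ : ℝ} (hT : 0 < T) (hδ : 0 < δ)
    (hV0 : 0 ≤ V 0) (hV : AntitoneOn V (Ici 0))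
    (hstep : ∀ a ≥ 0, V (a + T) ≤ Real.exp (-δ) * V a) {t : ℝ} (ht : 0 ≤ t) :
    V t ≤ Real.exp δ * Real.exp (-(δ / T) * t) * V 0 := by
  have hn : ∀ n : ℕ, V (n * T) ≤ Real.exp (-(δ * n)) * V 0 := by
    intro n
    induction n with
    | zero => simp
    | succ n ih =>
      have h := hstep (n * T) (by positivity)
      calc V ((n + 1 : ℕ) * T) = V (n * T + T) := by push_cast; ring_nf
        _ ≤ Real.exp (-δ) * V (n * T) := h
        _ ≤ Real.exp (-δ) * (Real.exp (-(δ * n)) * V 0) := by gcongr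
        _ = Real.exp (-(δ * (n + 1 : ℕ))) * V 0 := by
          rw [← mul_assoc, ← Real.exp_add]; push_cast; ring_nf
  have hfl : (⌊t / T⌋₊ : ℝ) * T ≤ t := by
    rw [← le_div_iff₀ hT]
    exact Nat.floor_le (by positivity)
  have hfl' : t / T < ⌊t / T⌋₊ + 1 := Nat.lt_floor_add_one _
  have h0 : (0 : ℝ) ≤ (⌊t / T⌋₊ : ℝ) * T := by positivity
  refine ((hV h0 ht hfl).trans (hn _)).trans ?_
  rw [← Real.exp_add]
  gcongr
  have : δ * (t / T) ≤ δ * (⌊t / T⌋₊ + 1) := by gcongr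
  have e : δ / T * t = δ * (t / T) := by ring
  linarith

/-- Global exponential stability of the origin for the linear time-varying
gradient-flow system `x' = -Γ A(t) x` under a persistency-of-excitation (PE)
condition on `A`, expressed via quadratic forms:
`ι·I ⪯ ∫_{t-T}^t A(s) ds` iff `ι‖v‖² ≤ ∫_{t-T}^t ⟪v, A(s)v⟫ ds` for all `v`. -/
theorem stmt_0
    (m : ℕ) (hm : 1 ≤ m)
    (Γ : EuclideanSpace ℝ (Fin m) →L[ℝ] EuclideanSpace ℝ (Fin m))
    (hΓsymm : ∀ v w, ⟪Γ v, w⟫ = ⟪v, Γ w⟫)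
    (hΓpos : ∀ v, v ≠ 0 → 0 < ⟪v, Γ v⟫)
    (A : ℝ → (EuclideanSpace ℝ (Fin m) →L[ℝ] EuclideanSpace ℝ (Fin m)))
    (hAcont : Continuous A)
    (hAsymm : ∀ t v w, ⟪A t v, w⟫ = ⟪v, A t w⟫)
    (hApsd : ∀ t v, 0 ≤ ⟪v, A t v⟫)
    (r : ℝ) (hr : 0 < r) (hAbd : ∀ t ≥ (0 : ℝ), ‖A t‖ ≤ r)
    (T ι : ℝ) (hT : 0 < T) (hι : 0 < ι)
    (hPE : ∀ t ≥ T, ∀ v : EuclideanSpace ℝ (Fin m),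
      ι * ‖v‖ ^ 2 ≤ ∫ s in (t - T)..t, ⟪v, A s v⟫) :
    ∃ κ > (0 : ℝ), ∃ γ > (0 : ℝ),
      ∀ x : ℝ → EuclideanSpace ℝ (Fin m),
        (∀ t ≥ (0 : ℝ), HasDerivWithinAt x (-(Γ (A t (x t)))) (Ici 0) t) →
        ∀ t ≥ (0 : ℝ), ‖x t‖ ≤ κ * Real.exp (-γ * t) * ‖x 0‖ := by
  have hinj : Function.Injective Γ.toLinearMap := by
    rw [← LinearMap.ker_eq_bot, LinearMap.ker_eq_bot']
    intro v hv
    by_contra hne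
    have h := hΓpos v hne
    have hv' : Γ v = 0 := hv
    simp [hv'] at h
  let e := (LinearEquiv.ofInjectiveEndo Γ.toLinearMap hinj).toContinuousLinearEquiv
  obtain ⟨P, hPΓ, hΓP⟩ : ∃ P : EuclideanSpace ℝ (Fin m) →L[ℝ] EuclideanSpace ℝ (Fin m),
      (∀ v, P (Γ v) = v) ∧ ∀ v, Γ (P v) = v :=
    ⟨e.symm, fun v => e.symm_apply_apply v, fun v => e.apply_symm_apply v⟩
  have hΓpsd : ∀ v, 0 ≤ ⟪v, Γ v⟫ := by
    intro v
    rcases eq_or_ne v 0 with rfl | hv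
    · simp
    · exact (hΓpos v hv).le
  have hlow : ∀ v, ‖v‖ ^ 2 ≤ ‖Γ‖ * ⟪v, P v⟫ := by
    intro v
    have h := norm_apply_sq_le_of_symm_of_nonneg Γ hΓsymm hΓpsd (P v)
    rwa [hΓP, real_inner_comm] at h
  have hVnn : ∀ v, 0 ≤ ⟪v, P v⟫ := by
    intro v
    have h := hΓpsd (P v)
    rwa [hΓP, real_inner_comm] at h
  have hup : ∀ v, ⟪v, P v⟫ ≤ ‖P‖ * ‖v‖ ^ 2 := by
    intro v
    calc ⟪v, P v⟫ ≤ ‖v‖ * ‖P v‖ := real_inner_le_norm _ _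
      _ ≤ ‖v‖ * (‖P‖ * ‖v‖) := by gcongr; exact P.le_opNorm _
      _ = ‖P‖ * ‖v‖ ^ 2 := by ring
  set C := 1 + T ^ 2 * ‖Γ‖ ^ 2 * r ^ 2 with hC
  have hCpos : 0 < C := by positivity
  set K := ‖P‖ * C / ι + 2 with hK
  have hK2 : 2 ≤ K := by
    have : 0 ≤ ‖P‖ * C / ι := by positivity
    linarith
  have hK0 : 0 < K := by linarith
  have hq0 : 0 < 1 - 1 / K := by
    rw [sub_pos, div_lt_one hK0]
    linarith
  have hq1 : 1 - 1 / K < 1 := by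
    have : 0 < 1 / K := by positivity
    linarith
  set δ := -Real.log (1 - 1 / K) with hδdef
  have hδ : 0 < δ := neg_pos.2 (Real.log_neg hq0 hq1)
  have hexp : Real.exp (-δ) = 1 - 1 / K := by rw [hδdef, neg_neg, Real.exp_log hq0]
  refine ⟨Real.sqrt ((‖Γ‖ * ‖P‖ + 1) * Real.exp δ), by positivity, δ / T / 2, by positivity, ?_⟩
  intro x hx t ht
  have hxc : ContinuousOn x (Ici 0) := fun t ht => (hx t ht).continuousWithinAt
  have hV : AntitoneOn (fun t => ⟪x t, P (x t)⟫) (Ici 0) := by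
    refine antitoneOn_of_hasDerivWithinAt_nonpos (convex_Ici 0)
      (f' := fun t => -(2 * ⟪x t, A t (x t)⟫))
      (hxc.inner (P.continuous.comp_continuousOn hxc)) (fun t ht => ?_) (fun t _ => ?_)
    · exact hasDerivWithinAt_inner_gradientFlow hΓsymm hPΓ hΓP
        ((hx t (interior_subset ht)).mono interior_subset)
    · linarith [hApsd t (x t)]
  have hstep : ∀ a ≥ 0, ⟪x (a + T), P (x (a + T))⟫ ≤ Real.exp (-δ) * ⟪x a, P (x a)⟫ := by
    intro a ha
    have hsub : Icc a (a + T) ⊆ Ici 0 := fun s hs => ha.le.trans hs.1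
    have hpe := hPE (a + T) (by linarith) (x a)
    rw [add_sub_cancel_right] at hpe
    have h := norm_sq_le_energy_drop hΓsymm hPΓ hΓP hAcont.continuousOn hAsymm hApsd
      (fun s hs => hAbd s (hsub hs))
      (fun s hs => (hx s (hsub hs)).mono (Ici_subset_Ici.2 (hsub hs)))
      (hxc.mono hsub) (by linarith) (hV.mono hsub) hpe
    rw [add_sub_cancel_left, ← hC] at h
    have hdrop : 0 ≤ ⟪x a, P (x a)⟫ - ⟪x (a + T), P (x (a + T))⟫ :=
      sub_nonneg.2 (hV ha (by simp; linarith) (by linarith))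
    have h1 : ⟪x a, P (x a)⟫ ≤ K * (⟪x a, P (x a)⟫ - ⟪x (a + T), P (x (a + T))⟫) := by
      calc ⟪x a, P (x a)⟫ ≤ ‖P‖ * ‖x a‖ ^ 2 := hup _
        _ = ‖P‖ / ι * (ι * ‖x a‖ ^ 2) := by field_simp
        _ ≤ ‖P‖ / ι * (C * (⟪x a, P (x a)⟫ - ⟪x (a + T), P (x (a + T))⟫)) := by gcongr
        _ = (K - 2) * (⟪x a, P (x a)⟫ - ⟪x (a + T), P (x (a + T))⟫) := by rw [hK]; ring
        _ ≤ _ := by gcongr; linarith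
    rw [hexp]
    have h2 : ⟪x a, P (x a)⟫ / K ≤ ⟪x a, P (x a)⟫ - ⟪x (a + T), P (x (a + T))⟫ := by
      rwa [div_le_iff₀' hK0]
    have h3 : (1 - 1 / K) * ⟪x a, P (x a)⟫ = ⟪x a, P (x a)⟫ - ⟪x a, P (x a)⟫ / K := by ring
    linarith
  have hdecay := le_exp_of_antitoneOn_of_contraction (V := fun t => ⟪x t, P (x t)⟫)
    hT hδ (hVnn _) hV hstep ht
  have hsq : Real.exp (-(δ / T) * t) = Real.exp (-(δ / T / 2) * t) ^ 2 := by
    rw [← Real.exp_nat_mul]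
    congr 1
    push_cast
    ring
  refine (pow_le_pow_iff_left₀ (norm_nonneg _) (by positivity) two_ne_zero).1 ?_
  rw [mul_pow, mul_pow, Real.sq_sqrt (by positivity), ← hsq]
  calc ‖x t‖ ^ 2 ≤ ‖Γ‖ * ⟪x t, P (x t)⟫ := hlow _
    _ ≤ ‖Γ‖ * (Real.exp δ * Real.exp (-(δ / T) * t) * ⟪x 0, P (x 0)⟫) := by gcongr
    _ ≤ ‖Γ‖ * (Real.exp δ * Real.exp (-(δ / T) * t) * (‖P‖ * ‖x 0‖ ^ 2)) := by
        gcongr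
        exact hup _
    _ = (‖Γ‖ * ‖P‖) * Real.exp δ * Real.exp (-(δ / T) * t) * ‖x 0‖ ^ 2 := by ring
    _ ≤ _ := by gcongr; linarith
end

section
/- Let n ≥ 1, α > 0, T > 0. Let c_j : ℝ → ℝⁿ (j = 1, …, n) be continuous with ‖c_j(t)‖² ≤ r₂ for all t ≥ 0 for some r₂ > 0, and let L : ℝ → ℝ^{n×n} be a continuous family of symmetric positive semidefinite matrices with L(t)𝟙 = 0. Assume (cooperative persistency of excitation) there exists ι̲ > 0 with ι̲·Iₙ ⪯ ∫_{t−T}^{t} Σ_j c_j(s)c_j(s)ᵀ ds for all t ≥ T, and (connectivity on average) there exists λ̲ > 0 with vᵀ(∫_{t−T}^{t} L(s) ds)v ≥ λ̲‖v‖² for all t ≥ T and all v ∈ ℝⁿ with vᵀ𝟙 = 0. Then there exists μ > 0, depending only on n, α, T, r₂, ι̲, λ̲, such that for all t ≥ T and all vectors w_1, …, w_n ∈ ℝⁿ: ∫_{t−T}^{t} [ Σ_j (c_j(s)ᵀ w_j)² + α Σ_{j,k} L(s)_{jk} (w_jᵀ w_k) ] ds ≥ μ Σ_j ‖w_j‖².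 In other words, the combined stacked regressor Λ̄ = [C̄; √α Dᵀ] (with C̄ the block-diagonal matrix of the c_jᵀ and D an incidence matrix with D Dᵀ = L) is itself persistently exciting on ℝ^{n²}. -/
open Set MeasureTheory intervalIntegral RealInnerProductSpace
open scoped Matrix

/-- The Laplacian form `∑ L_{jk} ⟪w_j, w_k⟫` is unchanged when all `w_j` are shifted by `m`. -/
theorem sum_mul_inner_sub_const {ι E : Type*} [Fintype ι] [NormedAddCommGroup E]
    [InnerProductSpace ℝ E] {L : Matrix ι ι ℝ} (hsymm : L.IsSymm)
    (hone : L *ᵥ (fun _ => (1 : ℝ)) = 0) (w : ι → E) (m : E) :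
    ∑ j, ∑ k, L j k * ⟪w j - m, w k - m⟫ = ∑ j, ∑ k, L j k * ⟪w j, w k⟫ := by
  have hrow : ∀ j, ∑ k, L j k = 0 := fun j => by
    simpa [Matrix.mulVec, dotProduct] using congrFun hone j
  have hcol : ∀ k, ∑ j, L j k = 0 := fun k => by
    simpa only [hsymm.apply] using hrow k
  have h₁ : ∑ j, ∑ k, L j k * ⟪w j, m⟫ = 0 := by
    simp [← Finset.sum_mul, hrow]
  have h₂ : ∑ j, ∑ k, L j k * ⟪m, w k⟫ = 0 := by
    rw [Finset.sum_comm]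
    simp [← Finset.sum_mul, hcol]
  have h₃ : ∑ j, ∑ k, L j k * ⟪m, m⟫ = 0 := by
    simp [← Finset.sum_mul, hrow]
  simp only [inner_sub_left, inner_sub_right, mul_sub, Finset.sum_sub_distrib, h₁, h₂, h₃, sub_zero]

/-- Coordinatewise form of `∑ L_{jk} ⟪d_j, d_k⟫`. -/
theorem sum_mul_inner_eq_sum_dotProduct {ι κ : Type*} [Fintype ι] [Fintype κ]
    (L : Matrix ι ι ℝ) (d : ι → EuclideanSpace ℝ κ) :
    ∑ j, ∑ k, L j k * ⟪d j, d k⟫ = ∑ i, (fun j => d j i) ⬝ᵥ (L *ᵥ (fun j => d j i)) := by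
  simp only [dotProduct, Matrix.mulVec, PiLp.inner_apply, Finset.mul_sum]
  rw [Finset.sum_comm (s := (Finset.univ : Finset κ))]
  refine Finset.sum_congr rfl fun j _ => ?_
  rw [Finset.sum_comm]
  refine Finset.sum_congr rfl fun i _ => Finset.sum_congr rfl fun k _ => ?_
  simp
  ring

/-- Splitting `w_j = m + d_j` bounds the regressor form below. -/
theorem half_sum_inner_sq_sub_le {ι E : Type*} [Fintype ι] [NormedAddCommGroup E]
    [InnerProductSpace ℝ E] {r : ℝ} {c : ι → E} (hc : ∀ j, ‖c j‖ ^ 2 ≤ r) (w : ι → E) (m : E) :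
    (∑ j, ⟪c j, m⟫ ^ 2) / 2 - r * ∑ j, ‖w j - m‖ ^ 2 ≤ ∑ j, ⟪c j, w j⟫ ^ 2 := by
  rw [Finset.sum_div, Finset.mul_sum, ← Finset.sum_sub_distrib]
  refine Finset.sum_le_sum fun j _ => ?_
  have h₁ : ⟪c j, w j - m⟫ ^ 2 ≤ r * ‖w j - m‖ ^ 2 := by
    calc ⟪c j, w j - m⟫ ^ 2 ≤ (‖c j‖ * ‖w j - m‖) ^ 2 :=
          sq_le_sq.mpr ((abs_real_inner_le_norm _ _).trans (le_abs_self _))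
      _ = ‖c j‖ ^ 2 * ‖w j - m‖ ^ 2 := mul_pow _ _ _
      _ ≤ r * ‖w j - m‖ ^ 2 := by gcongr; exact hc j
  rw [inner_sub_right] at h₁
  nlinarith [sq_nonneg (2 * ⟪c j, w j⟫ - ⟪c j, m⟫)]

/-- Cooperative persistency of excitation of the local regressors together with
connectivity on average of the communication graph imply persistency of
excitation of the combined stacked regressor `Λ̄ = [C̄; √α Dᵀ]` on `ℝ^{n²}`:
there is `μ > 0` (depending only on `n, α, T, r₂, ι̲, λ̲`) with
`∫_{t−T}^t [ Σ_j (c_jᵀ w_j)² + α Σ_{j,k} L_{jk} w_jᵀ w_k ] ds ≥ μ Σ_j ‖w_j‖²`. -/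
theorem stmt_4
    (n : ℕ) (hn : 1 ≤ n)
    (α T r₂ ιlo lam : ℝ)
    (hα : 0 < α) (hT : 0 < T) (hr₂ : 0 < r₂) (hιlo : 0 < ιlo) (hlam : 0 < lam) :
    ∃ μ > (0 : ℝ),
      ∀ (c : Fin n → ℝ → EuclideanSpace ℝ (Fin n))
        (L : ℝ → Matrix (Fin n) (Fin n) ℝ),
        (∀ j, Continuous (c j)) →
        (∀ j, ∀ t ≥ (0 : ℝ), ‖c j t‖ ^ 2 ≤ r₂) →
        Continuous L →
        (∀ t, (L t).IsSymm) →
        (∀ t, (L t).PosSemidef) →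
        (∀ t, (L t) *ᵥ (fun _ => (1 : ℝ)) = 0) →
        -- cooperative persistency of excitation
        (∀ t ≥ T, ∀ v : EuclideanSpace ℝ (Fin n),
          ιlo * ‖v‖ ^ 2 ≤ ∫ s in (t - T)..t, ∑ j, ⟪c j s, v⟫ ^ 2) →
        -- connectivity on average
        (∀ t ≥ T, ∀ v : Fin n → ℝ, (∑ j, v j) = 0 →
          lam * (∑ j, v j ^ 2) ≤ ∫ s in (t - T)..t, v ⬝ᵥ ((L s) *ᵥ v)) →
        ∀ t ≥ T, ∀ w : Fin n → EuclideanSpace ℝ (Fin n),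
          μ * ∑ j, ‖w j‖ ^ 2 ≤
            ∫ s in (t - T)..t,
              ((∑ j, ⟪c j s, w j⟫ ^ 2) + α * ∑ j, ∑ k, L s j k * ⟪w j, w k⟫) := by
  have hn₀ : (0 : ℝ) < n := by exact_mod_cast hn
  obtain ⟨κ, hκ, hκ₁, hκr⟩ : ∃ κ > (0 : ℝ), κ ≤ 1 ∧ κ * (r₂ * T) ≤ α * lam / 2 := by
    refine ⟨min 1 (α * lam / 2 / (r₂ * T)), by positivity, min_le_left _ _, ?_⟩
    rw [← le_div_iff₀ (by positivity)]
    exact min_le_right _ _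
  refine ⟨min (κ * ιlo / (4 * n)) (α * lam / 4), by positivity, ?_⟩
  intro c L hc hcr hL hsymm _ hone hpe hconn t ht w
  set m : EuclideanSpace ℝ (Fin n) := (n : ℝ)⁻¹ • ∑ j, w j with hm
  set D : ℝ := ∑ j, ‖w j - m‖ ^ 2 with hD
  have hD₀ : 0 ≤ D := by positivity
  have hcent : ∀ i, ∑ j, (w j - m) i = 0 := fun i => by
    simp [hm, mul_inv_cancel_left₀ hn₀.ne']
  have hDcoord : D = ∑ i, ∑ j, (w j - m) i ^ 2 := by
    rw [hD, Finset.sum_comm]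
    exact Finset.sum_congr rfl fun j _ => EuclideanSpace.real_norm_sq_eq _
  have hLentry : ∀ j k, Continuous fun s => L s j k := fun j k => hL.matrix_elem j k
  have hA : Continuous fun s => ∑ j, ⟪c j s, m⟫ ^ 2 := by fun_prop
  have hA' : Continuous fun s => ∑ j, ⟪c j s, w j⟫ ^ 2 := by fun_prop
  have hB : Continuous fun s => ∑ j, ∑ k, L s j k * ⟪w j, w k⟫ := by fun_prop
  have hBint : lam * D ≤ ∫ s in (t - T)..t, ∑ j, ∑ k, L s j k * ⟪w j, w k⟫ := by
    have heq : ∀ s, ∑ j, ∑ k, L s j k * ⟪w j, w k⟫ =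
        ∑ i, (fun j => (w j - m) i) ⬝ᵥ (L s *ᵥ (fun j => (w j - m) i)) := fun s => by
      rw [← sum_mul_inner_sub_const (hsymm s) (hone s) w m, sum_mul_inner_eq_sum_dotProduct]
    simp only [heq]
    rw [intervalIntegral.integral_finsetSum, hDcoord, Finset.mul_sum]
    · exact Finset.sum_le_sum fun i _ => hconn t ht _ (hcent i)
    · intro i _
      refine Continuous.intervalIntegrable ?_ _ _
      exact continuous_const.dotProduct (hL.matrix_mulVec continuous_const)
  have hAint := hpe t ht m
  have hAint' : ιlo * ‖m‖ ^ 2 / 2 - r₂ * D * T ≤ ∫ s in (t - T)..t, ∑ j, ⟪c j s, w j⟫ ^ 2 := by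
    calc ιlo * ‖m‖ ^ 2 / 2 - r₂ * D * T
        ≤ ∫ s in (t - T)..t, ((∑ j, ⟪c j s, m⟫ ^ 2) / 2 - r₂ * D) := by
          rw [intervalIntegral.integral_sub ((hA.div_const 2).intervalIntegrable _ _)
            intervalIntegrable_const, intervalIntegral.integral_div,
            intervalIntegral.integral_const, smul_eq_mul]
          linarith
      _ ≤ _ := by
          refine intervalIntegral.integral_mono_on (by linarith)
            (((hA.div_const 2).sub continuous_const).intervalIntegrable _ _)
            (hA'.intervalIntegrable _ _) fun s hs => ?_
          exact half_sum_inner_sq_sub_le (fun j => hcr j s (by linarith [hs.1])) w m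
  have hA₀ : 0 ≤ ∫ s in (t - T)..t, ∑ j, ⟪c j s, w j⟫ ^ 2 :=
    intervalIntegral.integral_nonneg (by linarith) fun s _ => by positivity
  have hsum : ∑ j, ‖w j‖ ^ 2 ≤ 2 * n * ‖m‖ ^ 2 + 2 * D := by
    have hj : ∀ j, ‖w j‖ ^ 2 ≤ 2 * ‖m‖ ^ 2 + 2 * ‖w j - m‖ ^ 2 := fun j => by
      have := norm_le_norm_add_norm_sub' (w j) m
      nlinarith [norm_nonneg (w j), sq_nonneg (‖m‖ - ‖w j - m‖)]
    refine (Finset.sum_le_sum fun j _ => hj j).trans_eq ?_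
    rw [Finset.sum_add_distrib, ← Finset.mul_sum, ← Finset.mul_sum, hD]
    simp
    ring
  rw [intervalIntegral.integral_add (hA'.intervalIntegrable _ _)
    ((hB.const_mul α).intervalIntegrable _ _), intervalIntegral.integral_const_mul]
  calc min (κ * ιlo / (4 * n)) (α * lam / 4) * ∑ j, ‖w j‖ ^ 2
      ≤ min (κ * ιlo / (4 * n)) (α * lam / 4) * (2 * n * ‖m‖ ^ 2 + 2 * D) := by gcongr
    _ ≤ κ * ιlo / (4 * n) * (2 * n * ‖m‖ ^ 2) + α * lam / 4 * (2 * D) := by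
        rw [mul_add]
        gcongr
        · exact min_le_left _ _
        · exact min_le_right _ _
    _ = κ * (ιlo * ‖m‖ ^ 2 / 2) + α * lam / 2 * D := by field_simp; ring
    _ ≤ κ * (ιlo * ‖m‖ ^ 2 / 2 - r₂ * D * T) + α * (lam * D) := by
        nlinarith [mul_le_mul_of_nonneg_right hκr hD₀]
    _ ≤ κ * (∫ s in (t - T)..t, ∑ j, ⟪c j s, w j⟫ ^ 2) +
          α * ∫ s in (t - T)..t, ∑ j, ∑ k, L s j k * ⟪w j, w k⟫ := by gcongr
    _ ≤ _ := by
        gcongr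
        exact mul_le_of_le_one_left hA₀ hκ₁
end

section
/- Under the standing assumptions (bounds, cooperative persistency of excitation, connectivity on average), there exist constants κ > 0, γ > 0 and β > 0, independent of the disturbance and of the initial condition, such that the following holds: for every θ ∈ ℝⁿ, every bounded continuous disturbance d = (d_1, …, d_n) : [0,∞) → (ℝⁿ)ⁿ with sup_{t ≥ 0} (Σ_j ‖d_j(t)‖²)^{1/2} ≤ δ, and every differentiable family θ̃_1, …, θ̃_n : [0,∞) → ℝⁿ satisfying the disturbed error dynamics θ̃_j'(t) = −α Γ_j (Σ_k L(t)_{jk} θ̃_k(t)) − Γ_j c_j(t)(c_j(t)ᵀθ̃_j(t)) + d_j(t), one has (Σ_j ‖θ̃_j(t)‖²)^{1/2} ≤ κ e^{−γ t} (Σ_j ‖θ̃_j(0)‖²)^{1/2} + β δ for all t ≥ 0 (input-to-state stability of the C+I error dynamics with respect to additive disturbances such as measurement noise and communication disturbances). -/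
open Set MeasureTheory intervalIntegral RealInnerProductSpace
open scoped Matrix

theorem norm_apply_sq_le_of_form_le {H : Type*} [NormedAddCommGroup H] [InnerProductSpace ℝ H]
    (A : H →L[ℝ] H) {M : ℝ} (hM : 0 < M) (hsymm : ∀ v w, ⟪A v, w⟫ = ⟪v, A w⟫)
    (hnonneg : ∀ v, 0 ≤ ⟪v, A v⟫) (hle : ∀ v, ⟪v, A v⟫ ≤ M * ‖v‖ ^ 2) (x : H) :
    ‖A x‖ ^ 2 ≤ M * ⟪x, A x⟫ := by
  have h := hnonneg (M • x - A x)
  have h2 := hle (A x)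
  simp only [map_sub, map_smul, inner_sub_left, inner_sub_right, real_inner_smul_left,
    real_inner_smul_right] at h
  rw [← hsymm x (A x), real_inner_self_eq_norm_sq] at h
  have h4 : M * ‖A x‖ ^ 2 ≤ M * (M * ⟪x, A x⟫) := by nlinarith
  exact le_of_mul_le_mul_left h4 hM

theorem exists_coercive_inverse {H : Type*} [NormedAddCommGroup H] [InnerProductSpace ℝ H]
    [FiniteDimensional ℝ H] (G : H →L[ℝ] H) {g : ℝ} (hg : 0 < g)
    (hsymm : ∀ v w, ⟪G v, w⟫ = ⟪v, G w⟫) (hpos : ∀ v, v ≠ 0 → 0 < ⟪v, G v⟫)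
    (hle : ∀ v, ‖G v‖ ≤ g * ‖v‖) :
    ∃ P : H →L[ℝ] H, (∀ v, P (G v) = v) ∧ (∀ v w, ⟪P v, w⟫ = ⟪v, P w⟫) ∧
      ∀ v, ‖v‖ ^ 2 ≤ g * ⟪v, P v⟫ := by
  have hinj : Function.Injective (G : H →ₗ[ℝ] H) := by
    rw [← LinearMap.ker_eq_bot, LinearMap.ker_eq_bot']
    intro v hv
    by_contra hne
    have h := hpos v hne
    have hv' : G v = 0 := hv
    simp [hv'] at h
  let e := LinearEquiv.ofInjectiveEndo (G : H →ₗ[ℝ] H) hinj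
  have he : ∀ v, e v = G v := fun v => rfl
  refine ⟨LinearMap.toContinuousLinearMap (e.symm : H →ₗ[ℝ] H), ?_, ?_, ?_⟩
  · intro v
    change e.symm (G v) = v
    rw [← he, e.symm_apply_apply]
  · intro v w
    change ⟪e.symm v, w⟫ = ⟪v, e.symm w⟫
    have h := hsymm (e.symm v) (e.symm w)
    rw [← he, ← he, e.apply_symm_apply, e.apply_symm_apply] at h
    exact h.symm
  · intro v
    change ‖v‖ ^ 2 ≤ g * ⟪v, e.symm v⟫
    have h := norm_apply_sq_le_of_form_le G hg hsymm
      (fun v => by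
        rcases eq_or_ne v 0 with rfl | hv
        · simp
        · exact (hpos v hv).le)
      (fun v => by
        have h1 := real_inner_le_norm v (G v)
        have h2 := mul_le_mul_of_nonneg_left (hle v) (norm_nonneg v)
        nlinarith) (e.symm v)
    rwa [← he, e.apply_symm_apply, real_inner_comm] at h

theorem le_exp_mul_add_of_hasDerivWithinAt {W W' : ℝ → ℝ} {l D : ℝ} (hl : 0 < l)
    (hD : 0 ≤ D)
    (hW : ∀ t ≥ (0 : ℝ), HasDerivWithinAt W (W' t) (Ici 0) t)
    (hle : ∀ t ≥ (0 : ℝ), W' t ≤ -l * W t + D) {t : ℝ} (ht : 0 ≤ t) :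
    W t ≤ Real.exp (-l * t) * W 0 + D / l := by
  have hder : ∀ s ≥ (0 : ℝ), HasDerivWithinAt (fun s => Real.exp (l * s) * (W s - D / l))
      (Real.exp (l * s) * l * (W s - D / l) + Real.exp (l * s) * W' s) (Ici 0) s := by
    intro s hs
    have h1 : HasDerivAt (fun s : ℝ => Real.exp (l * s)) (Real.exp (l * s) * l) s := by
      simpa using ((hasDerivAt_id s).const_mul l).exp
    exact h1.hasDerivWithinAt.mul ((hW s hs).sub_const _)
  have hanti : AntitoneOn (fun s => Real.exp (l * s) * (W s - D / l)) (Ici 0) := by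
    refine antitoneOn_of_hasDerivWithinAt_nonpos (convex_Ici 0)
      (fun s hs => (hder s hs).continuousWithinAt)
      (fun s hs => (hder s (interior_subset hs)).mono interior_subset) ?_
    intro s hs
    have h := hle s (interior_subset hs)
    have he := Real.exp_pos (l * s)
    have : l * (D / l) = D := by field_simp
    nlinarith
  have h := hanti (mem_Ici.2 le_rfl) (mem_Ici.2 ht) ht
  simp only [mul_zero, Real.exp_zero, one_mul] at h
  have he : Real.exp (-l * t) * Real.exp (l * t) = 1 := by
    rw [← Real.exp_add]; simp
  have h2 := mul_le_mul_of_nonneg_left h (Real.exp_pos (-l * t)).le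
  rw [← mul_assoc, he, one_mul] at h2
  have h3 : 0 ≤ Real.exp (-l * t) * (D / l) := by positivity
  linarith

theorem exists_iterated_integral_antiderivative {F : Type*} [NormedAddCommGroup F]
    [NormedSpace ℝ F] [CompleteSpace F] {A : ℝ → F} (hA : Continuous A) {M T : ℝ} (hT : 0 < T)
    (hbd : ∀ t ≥ (0 : ℝ), ‖A t‖ ≤ M) :
    ∃ S : ℝ → F, (∀ t ≥ (0 : ℝ), ‖S t‖ ≤ M * T * T) ∧
      ∀ t, HasDerivAt S ((∫ s in t..(t + T), A s) - T • A t) t := by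
  have hder : ∀ {B : ℝ → F}, Continuous B → ∀ t,
      HasDerivAt (fun t => ∫ s in (0 : ℝ)..t, B s) (B t) t :=
    fun hB t => (hB.integral_hasStrictDerivAt 0 t).hasDerivAt
  have hsub : ∀ {B : ℝ → F}, Continuous B → ∀ a b,
      (∫ s in (0 : ℝ)..b, B s) - (∫ s in (0 : ℝ)..a, B s) = ∫ s in a..b, B s :=
    fun hB a b => integral_interval_sub_left (hB.intervalIntegrable _ _) (hB.intervalIntegrable _ _)
  set I : ℝ → F := fun t => ∫ s in (0 : ℝ)..t, A s with hI
  have hIc : Continuous I := continuous_iff_continuousAt.2 fun t => (hder hA t).continuousAt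
  refine ⟨fun t => ∫ s in t..(t + T), (I s - I t), ?_, ?_⟩
  · intro t ht
    have h := norm_integral_le_of_norm_le_const (a := t) (b := t + T)
      (f := fun s => I s - I t) (C := M * T) ?_
    · simpa [abs_of_pos hT] using h
    · intro s hs
      rw [uIoc_of_le (by linarith)] at hs
      rw [hI]; simp only; rw [hsub hA]
      have h := norm_integral_le_of_norm_le_const (a := t) (b := s) (f := A) (C := M) ?_
      · refine h.trans ?_
        have hM : 0 ≤ M := (norm_nonneg _).trans (hbd t ht)
        rw [abs_of_pos (by linarith [hs.1])]
        exact mul_le_mul_of_nonneg_left (by linarith [hs.2]) hM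
      · intro r hr
        rw [uIoc_of_le hs.1.le] at hr
        exact hbd r (by linarith [hr.1])
  · intro t
    have hS : (fun t => ∫ s in t..(t + T), (I s - I t)) =
        fun t => ((∫ s in (0 : ℝ)..(t + T), I s) - ∫ s in (0 : ℝ)..t, I s) - T • I t := by
      funext t
      rw [intervalIntegral.integral_sub (hIc.intervalIntegrable _ _)
        (continuous_const.intervalIntegrable _ _), hsub hIc]
      simp
    rw [hS, ← hsub hA]
    exact (((hder hIc (t + T)).comp_add_const t T).sub (hder hIc t)).sub ((hder hA t).const_smul T)

set_option maxHeartbeats 1000000 in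
theorem exists_iss_estimate {H : Type*} [NormedAddCommGroup H] [InnerProductSpace ℝ H]
    [FiniteDimensional ℝ H] (G : H →L[ℝ] H) (A : ℝ → H →L[ℝ] H) {g M T μ : ℝ}
    (hg : 0 < g) (hM : 0 < M) (hT : 0 < T) (hμ : 0 < μ)
    (hGsymm : ∀ v w, ⟪G v, w⟫ = ⟪v, G w⟫) (hGpos : ∀ v, v ≠ 0 → 0 < ⟪v, G v⟫)
    (hGle : ∀ v, ‖G v‖ ≤ g * ‖v‖) (hA : Continuous A)
    (hAsymm : ∀ t v w, ⟪A t v, w⟫ = ⟪v, A t w⟫) (hAnonneg : ∀ t v, 0 ≤ ⟪v, A t v⟫)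
    (hAle : ∀ t ≥ (0 : ℝ), ∀ v, ⟪v, A t v⟫ ≤ M * ‖v‖ ^ 2)
    (hPE : ∀ t ≥ (0 : ℝ), ∀ v, μ * ‖v‖ ^ 2 ≤ ∫ s in t..(t + T), ⟪v, A s v⟫) :
    ∃ κ > (0 : ℝ), ∃ γ > (0 : ℝ), ∃ β > (0 : ℝ), ∀ (δ : ℝ) (d x : ℝ → H),
      (∀ t ≥ (0 : ℝ), ‖d t‖ ≤ δ) →
      (∀ t ≥ (0 : ℝ), HasDerivWithinAt x (-(G (A t (x t))) + d t) (Ici 0) t) →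
      ∀ t ≥ (0 : ℝ), ‖x t‖ ≤ κ * Real.exp (-γ * t) * ‖x 0‖ + β * δ := by
  have hAsq : ∀ t ≥ (0 : ℝ), ∀ v, ‖A t v‖ ^ 2 ≤ M * ⟪v, A t v⟫ := fun t ht =>
    norm_apply_sq_le_of_form_le (A t) hM (hAsymm t) (hAnonneg t) (hAle t ht)
  have hAnorm : ∀ t ≥ (0 : ℝ), ‖A t‖ ≤ M := by
    intro t ht
    refine ContinuousLinearMap.opNorm_le_bound _ hM.le fun v => ?_
    refine abs_le_of_sq_le_sq' ?_ (by positivity) |>.2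
    have h1 := hAsq t ht v
    have h2 := mul_le_mul_of_nonneg_left (hAle t ht v) hM.le
    nlinarith
  obtain ⟨P, hPG, hPsymm, hPcoer⟩ := exists_coercive_inverse G hg hGsymm hGpos hGle
  obtain ⟨S, hSbd, hSder⟩ := exists_iterated_integral_antiderivative hA hT hAnorm
  set σ := M * T * T with hσ
  have hσ0 : 0 < σ := by positivity
  set p := ‖P‖ with hp
  have hp0 : 0 ≤ p := norm_nonneg _
  set K := T + 4 * σ ^ 2 * g ^ 2 * M / μ + g * (σ + 1) with hK
  have hK0 : 0 < K := by positivity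
  set w := K * p + σ + 1 with hw
  have hw0 : 0 < w := by positivity
  set l := μ / (2 * w) with hl
  have hl0 : 0 < l := by positivity
  set C := 4 * (K * p + σ) ^ 2 / μ with hC
  have hC0 : 0 < C := by positivity
  have hSb : ∀ t ≥ (0 : ℝ), ∀ u v, |⟪u, S t v⟫| ≤ σ * (‖u‖ * ‖v‖) := by
    intro t ht u v
    refine (abs_real_inner_le_norm _ _).trans ?_
    have h := (S t).le_of_opNorm_le (hSbd t ht) v
    nlinarith [mul_le_mul_of_nonneg_left h (norm_nonneg u)]
  have hPb : ∀ u v, |⟪u, P v⟫| ≤ p * (‖u‖ * ‖v‖) := by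
    intro u v
    refine (abs_real_inner_le_norm _ _).trans ?_
    nlinarith [mul_le_mul_of_nonneg_left (P.le_opNorm v) (norm_nonneg u)]
  refine ⟨Real.sqrt w, Real.sqrt_pos.2 hw0, l / 2, by positivity, Real.sqrt (C / l),
    Real.sqrt_pos.2 (by positivity), ?_⟩
  intro δ d x hd hx t ht
  have hδ : 0 ≤ δ := (norm_nonneg _).trans (hd 0 le_rfl)
  set W : ℝ → ℝ := fun t => K * ⟪x t, P (x t)⟫ - ⟪x t, S t (x t)⟫ with hW
  have hWlow : ∀ t ≥ (0 : ℝ), ‖x t‖ ^ 2 ≤ W t := by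
    intro t ht
    have h1 := (abs_le.1 (hSb t ht (x t) (x t))).2
    have h2 := hPcoer (x t)
    have h3 : g * (σ + 1) ≤ K := by
      have : 0 ≤ T + 4 * σ ^ 2 * g ^ 2 * M / μ := by positivity
      linarith
    have h4 : 0 ≤ ⟪x t, P (x t)⟫ := by
      by_contra hneg
      nlinarith [sq_nonneg ‖x t‖]
    have h5 := mul_le_mul_of_nonneg_right h3 h4
    simp only [hW]
    nlinarith
  have hWup : ∀ t ≥ (0 : ℝ), W t ≤ w * ‖x t‖ ^ 2 := by
    intro t ht
    have h1 := (abs_le.1 (hSb t ht (x t) (x t))).1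
    have h2 := mul_le_mul_of_nonneg_left (abs_le.1 (hPb (x t) (x t))).2 hK0.le
    simp only [hW, hw]
    nlinarith [sq_nonneg ‖x t‖]
  have hWder := fun (t : ℝ) (ht : t ≥ 0) =>
    (((hx t ht).inner ℝ (P.hasFDerivAt.comp_hasDerivWithinAt t (hx t ht))).const_mul K).sub
      ((hx t ht).inner ℝ ((hSder t).hasDerivWithinAt.clm_apply (hx t ht)))
  have hWle := le_exp_mul_add_of_hasDerivWithinAt (W := W) (D := C * δ ^ 2) hl0
    (by positivity) hWder ?_ ht
  · have h1 := hWlow t ht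
    have h2 := mul_le_mul_of_nonneg_left (hWup 0 le_rfl) (Real.exp_pos (-l * t)).le
    refine abs_le_of_sq_le_sq' ?_ (by positivity) |>.2
    have e1 : Real.exp (-(l / 2) * t) ^ 2 = Real.exp (-l * t) := by
      rw [← Real.exp_nat_mul]; congr 1; push_cast; ring
    have e2 : (Real.sqrt w * Real.exp (-(l / 2) * t) * ‖x 0‖) ^ 2
        = Real.exp (-l * t) * (w * ‖x 0‖ ^ 2) := by
      rw [mul_pow, mul_pow, e1, Real.sq_sqrt hw0.le]; ring
    have e3 : (Real.sqrt (C / l) * δ) ^ 2 = C * δ ^ 2 / l := by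
      rw [mul_pow, Real.sq_sqrt (by positivity)]; ring
    have h3 : 0 ≤ (Real.sqrt w * Real.exp (-(l / 2) * t) * ‖x 0‖) * (Real.sqrt (C / l) * δ) := by
      positivity
    rw [add_sq, e2, e3]
    linarith
  · intro t ht
    have hP' : ∀ v, ⟪x t, P (-(G (A t (x t))) + v)⟫ = -⟪x t, A t (x t)⟫ + ⟪x t, P v⟫ := by
      intro v
      rw [map_add, map_neg, hPG, inner_add_right, inner_neg_right]
    have hInt : ⟪x t, (∫ s in t..(t + T), A s) (x t)⟫ = ∫ s in t..(t + T), ⟪x t, A s (x t)⟫ := by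
      rw [ContinuousLinearMap.intervalIntegral_apply (hA.intervalIntegrable _ _)]
      exact ((innerSL ℝ (x t)).intervalIntegral_comp_comm
        ((hA.clm_apply continuous_const).intervalIntegrable _ _)).symm
    set x' := -(G (A t (x t))) + d t with hx'
    have hx'n : ‖x'‖ ≤ g * ‖A t (x t)‖ + δ := by
      refine (norm_add_le _ _).trans ?_
      rw [norm_neg]
      exact add_le_add (hGle _) (hd t ht)
    have hflip : ⟪x', P (x t)⟫ = ⟪x t, P x'⟫ := by
      rw [← hPsymm, real_inner_comm]
    have hcoe : (⟪x t, ((∫ s in t..(t + T), A s) - T • A t) (x t) + S t x'⟫ : ℝ)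
        = (∫ s in t..(t + T), ⟪x t, A s (x t)⟫) - T * ⟪x t, A t (x t)⟫ + ⟪x t, S t x'⟫ := by
      rw [inner_add_right, sub_apply, inner_sub_right, hInt, smul_apply, inner_smul_right]
    rw [hcoe]
    change K * (⟪x t, P x'⟫ + ⟪x', P (x t)⟫) - _ ≤ _
    rw [hflip, hx', hP', ← hx']
    have b1 := (abs_le.1 (hSb t ht (x t) x')).1
    have b2 := (abs_le.1 (hSb t ht x' (x t))).1
    have b3 := (abs_le.1 (hPb (x t) (d t))).2
    have b4 := hPE t ht (x t)
    have b5 := hAsq t ht (x t)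
    have b6 := hWup t ht
    have b7 := hAnonneg t (x t)
    have b8 := hd t ht
    set a := ⟪x t, A t (x t)⟫
    set X := ‖x t‖ with hX
    have hX0 : 0 ≤ X := norm_nonneg _
    set Y := ‖A t (x t)‖
    have c1 : σ * (X * ‖x'‖) ≤ σ * (X * (g * Y + δ)) := by gcongr
    have c2 : p * (X * ‖d t‖) ≤ p * (X * δ) := by gcongr
    have c3 : K * ⟪x t, P (d t)⟫ ≤ K * (p * (X * δ)) := by gcongr; linarith
    have c4 : 2 * σ * g * X * Y ≤ μ / 4 * X ^ 2 + 4 * σ ^ 2 * g ^ 2 / μ * Y ^ 2 := by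
      have h := sq_nonneg (μ * X - 4 * σ * g * Y)
      have e : μ / 4 * X ^ 2 + 4 * σ ^ 2 * g ^ 2 / μ * Y ^ 2 - 2 * σ * g * X * Y
          = (μ * X - 4 * σ * g * Y) ^ 2 / (4 * μ) := by field_simp; ring
      have : 0 ≤ (μ * X - 4 * σ * g * Y) ^ 2 / (4 * μ) := by positivity
      linarith
    have c5 : 2 * (K * p + σ) * X * δ ≤ μ / 4 * X ^ 2 + C * δ ^ 2 := by
      have e : μ / 4 * X ^ 2 + C * δ ^ 2 - 2 * (K * p + σ) * X * δ
          = (μ * X - 4 * (K * p + σ) * δ) ^ 2 / (4 * μ) := by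
        rw [hC]; field_simp; ring
      have : 0 ≤ (μ * X - 4 * (K * p + σ) * δ) ^ 2 / (4 * μ) := by positivity
      linarith
    have c6 : 4 * σ ^ 2 * g ^ 2 / μ * Y ^ 2 ≤ (4 * σ ^ 2 * g ^ 2 * M / μ) * a := by
      have h : 4 * σ ^ 2 * g ^ 2 / μ * Y ^ 2 ≤ 4 * σ ^ 2 * g ^ 2 / μ * (M * a) := by gcongr
      refine h.trans (le_of_eq ?_)
      ring
    have c7 : (T + 4 * σ ^ 2 * g ^ 2 * M / μ) * a ≤ K * a := by
      refine mul_le_mul_of_nonneg_right ?_ b7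
      have : 0 ≤ g * (σ + 1) := by positivity
      linarith
    have c8 : 0 ≤ K * a := by positivity
    have c9 : l * W t ≤ μ / 2 * X ^ 2 := by
      refine (mul_le_mul_of_nonneg_left b6 hl0.le).trans (le_of_eq ?_)
      rw [hl]; field_simp
    linarith

/-- The blockwise action `x ↦ (Γ_j x_j)_j` on stacked vectors. -/
noncomputable def blockDiagonalCLM {n : ℕ}
    (Γ : Fin n → (EuclideanSpace ℝ (Fin n) →L[ℝ] EuclideanSpace ℝ (Fin n))) :
    PiLp 2 (fun _ : Fin n => EuclideanSpace ℝ (Fin n)) →L[ℝ]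
      PiLp 2 (fun _ : Fin n => EuclideanSpace ℝ (Fin n)) :=
  (PiLp.continuousLinearEquiv 2 ℝ (fun _ : Fin n => EuclideanSpace ℝ (Fin n))).symm ∘L
    ContinuousLinearMap.pi fun j => Γ j ∘L PiLp.proj 2 _ j

@[simp]
theorem blockDiagonalCLM_apply {n : ℕ}
    (Γ : Fin n → (EuclideanSpace ℝ (Fin n) →L[ℝ] EuclideanSpace ℝ (Fin n)))
    (x : PiLp 2 (fun _ : Fin n => EuclideanSpace ℝ (Fin n))) (j : Fin n) :
    blockDiagonalCLM Γ x j = Γ j (x j) := rfl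

/-- The operator `x ↦ (α ∑ₖ L_jk x_k + ⟪c_j, x_j⟫ c_j)_j` on stacked vectors. -/
noncomputable def consensusInnovationCLM {n : ℕ} (α : ℝ) (L : Matrix (Fin n) (Fin n) ℝ)
    (c : Fin n → EuclideanSpace ℝ (Fin n)) :
    PiLp 2 (fun _ : Fin n => EuclideanSpace ℝ (Fin n)) →L[ℝ]
      PiLp 2 (fun _ : Fin n => EuclideanSpace ℝ (Fin n)) :=
  (PiLp.continuousLinearEquiv 2 ℝ (fun _ : Fin n => EuclideanSpace ℝ (Fin n))).symm ∘L
    ContinuousLinearMap.pi fun j => α • (∑ k, L j k • PiLp.proj 2 _ k) +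
      (innerSL ℝ (c j) ∘L PiLp.proj 2 _ j).smulRight (c j)

@[simp]
theorem consensusInnovationCLM_apply {n : ℕ} (α : ℝ) (L : Matrix (Fin n) (Fin n) ℝ)
    (c : Fin n → EuclideanSpace ℝ (Fin n))
    (x : PiLp 2 (fun _ : Fin n => EuclideanSpace ℝ (Fin n))) (j : Fin n) :
    consensusInnovationCLM α L c x j = α • (∑ k, L j k • x k) + ⟪c j, x j⟫ • c j := by
  simp [consensusInnovationCLM]

theorem inner_consensusInnovationCLM {n : ℕ} (α : ℝ) (L : Matrix (Fin n) (Fin n) ℝ)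
    (c : Fin n → EuclideanSpace ℝ (Fin n))
    (v w : PiLp 2 (fun _ : Fin n => EuclideanSpace ℝ (Fin n))) :
    ⟪v, consensusInnovationCLM α L c w⟫ =
      α * (∑ i, (fun j => v j i) ⬝ᵥ (L *ᵥ fun j => w j i)) + ∑ j, ⟪c j, w j⟫ * ⟪c j, v j⟫ := by
  have h : ∑ j, ∑ k, L j k * ⟪v j, w k⟫ = ∑ i, (fun j => v j i) ⬝ᵥ (L *ᵥ fun j => w j i) := by
    simp only [dotProduct, Matrix.mulVec, Finset.mul_sum]
    rw [Finset.sum_comm]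
    simp only [PiLp.inner_apply, Finset.mul_sum]
    rw [Finset.sum_comm]
    have : ∀ j k : Fin n, ∑ i, L k j * inner ℝ ((v k) i) ((w j) i)
        = ∑ i, (v k) i * (L k j * (w j) i) := fun j k =>
      Finset.sum_congr rfl fun i _ => by simp; ring
    simp only [this]
    rw [Finset.sum_congr rfl fun k _ => Finset.sum_comm, Finset.sum_comm]
  rw [PiLp.inner_apply, ← h, Finset.mul_sum, ← Finset.sum_add_distrib]
  refine Finset.sum_congr rfl fun j _ => ?_
  rw [consensusInnovationCLM_apply, inner_add_right, inner_smul_right, inner_smul_right, inner_sum,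
    real_inner_comm (c j) (v j)]
  simp only [inner_smul_right]

theorem sum_sum_sq_eq_norm_sq {n : ℕ} (x : PiLp 2 (fun _ : Fin n => EuclideanSpace ℝ (Fin n))) :
    ∑ i, ∑ j, (x j i) ^ 2 = ‖x‖ ^ 2 := by
  rw [PiLp.norm_sq_eq_of_L2, Finset.sum_comm]
  refine Finset.sum_congr rfl fun j _ => ?_
  rw [EuclideanSpace.real_norm_sq_eq]

theorem inner_consensusInnovationCLM_le {n : ℕ} {α r₂ r₃ : ℝ} (hα : 0 ≤ α)
    (L : Matrix (Fin n) (Fin n) ℝ) (c : Fin n → EuclideanSpace ℝ (Fin n))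
    (hc : ∀ j, ‖c j‖ ^ 2 ≤ r₂) (hL : ‖Matrix.toEuclideanCLM (𝕜 := ℝ) L‖ ≤ r₃)
    (v : PiLp 2 (fun _ : Fin n => EuclideanSpace ℝ (Fin n))) :
    ⟪v, consensusInnovationCLM α L c v⟫ ≤ (α * r₃ + r₂) * ‖v‖ ^ 2 := by
  have h1 : ∀ u : Fin n → ℝ, u ⬝ᵥ (L *ᵥ u) ≤ r₃ * ∑ j, u j ^ 2 := by
    intro u
    have e := Matrix.inner_toEuclideanCLM L (WithLp.toLp 2 u) (WithLp.toLp 2 u)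
    have h2 := (Matrix.toEuclideanCLM (𝕜 := ℝ) L).le_of_opNorm_le hL (WithLp.toLp 2 u)
    have h3 := real_inner_le_norm (WithLp.toLp 2 u) (Matrix.toEuclideanCLM (𝕜 := ℝ) L
      (WithLp.toLp 2 u))
    have h4 := EuclideanSpace.real_norm_sq_eq (WithLp.toLp 2 u)
    have h5 := mul_le_mul_of_nonneg_left h2 (norm_nonneg (WithLp.toLp 2 u))
    simp only at h4 e
    rw [← e, ← h4]
    nlinarith
  have h2 : ∑ j, ⟪c j, v j⟫ * ⟪c j, v j⟫ ≤ r₂ * ‖v‖ ^ 2 := by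
    rw [PiLp.norm_sq_eq_of_L2, Finset.mul_sum]
    refine Finset.sum_le_sum fun j _ => ?_
    refine (real_inner_mul_inner_self_le (c j) (v j)).trans ?_
    rw [real_inner_self_eq_norm_sq, real_inner_self_eq_norm_sq]
    exact mul_le_mul_of_nonneg_right (hc j) (sq_nonneg _)
  have h3 : ∑ i, (fun j => v j i) ⬝ᵥ (L *ᵥ fun j => v j i) ≤ r₃ * ‖v‖ ^ 2 := by
    rw [← sum_sum_sq_eq_norm_sq, Finset.mul_sum]
    exact Finset.sum_le_sum fun i _ => h1 _
  rw [inner_consensusInnovationCLM]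
  nlinarith [mul_le_mul_of_nonneg_left h3 hα]

theorem continuous_consensusInnovationCLM {n : ℕ} (α : ℝ) {L : ℝ → Matrix (Fin n) (Fin n) ℝ}
    {c : Fin n → ℝ → EuclideanSpace ℝ (Fin n)} (hL : Continuous L) (hc : ∀ j, Continuous (c j)) :
    Continuous fun t => consensusInnovationCLM α (L t) fun j => c j t := by
  rw [continuous_clm_apply]
  intro x
  have h : ∀ j k, Continuous fun t => L t j k := fun j k => hL.matrix_elem j k
  refine (PiLp.continuous_toLp 2 _).comp (continuous_pi fun j => ?_)
  change Continuous fun t => consensusInnovationCLM α (L t) (fun j => c j t) x j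
  simp only [consensusInnovationCLM_apply]
  have hcj := hc j
  have hjk := h j
  fun_prop

theorem mulVec_sub_const {n : ℕ} (L : Matrix (Fin n) (Fin n) ℝ) (hsymm : L.IsSymm)
    (h1 : L *ᵥ (fun _ => (1 : ℝ)) = 0) (u : Fin n → ℝ) (a : ℝ) :
    (u - fun _ => a) ⬝ᵥ (L *ᵥ (u - fun _ => a)) = u ⬝ᵥ (L *ᵥ u) := by
  have ha : L *ᵥ (fun _ => a) = 0 := by
    have : (fun _ : Fin n => a) = a • (fun _ => (1 : ℝ)) := by ext; simp
    rw [this, Matrix.mulVec_smul, h1, smul_zero]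
  have hb : (fun _ => a) ⬝ᵥ (L *ᵥ u) = 0 := by
    rw [Matrix.dotProduct_mulVec, ← Matrix.mulVec_transpose, hsymm.eq, ha, zero_dotProduct]
  rw [Matrix.mulVec_sub, ha, sub_zero, sub_dotProduct, hb, sub_zero]

theorem exists_persistent_excitation {n : ℕ} (hn : 1 ≤ n) {α r₂ T ιlo lam : ℝ}
    (hα : 0 < α) (hr₂ : 0 < r₂) (hT : 0 < T) (hιlo : 0 < ιlo) (hlam : 0 < lam)
    (c : Fin n → ℝ → EuclideanSpace ℝ (Fin n)) (L : ℝ → Matrix (Fin n) (Fin n) ℝ)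
    (hccont : ∀ j, Continuous (c j)) (hcbd : ∀ j, ∀ t ≥ (0 : ℝ), ‖c j t‖ ^ 2 ≤ r₂)
    (hLcont : Continuous L) (hLsymm : ∀ t, (L t).IsSymm)
    (hL1 : ∀ t, (L t) *ᵥ (fun _ => (1 : ℝ)) = 0)
    (hPE : ∀ t ≥ (0 : ℝ), ∀ v : EuclideanSpace ℝ (Fin n),
      ιlo * ‖v‖ ^ 2 ≤ ∫ s in t..(t + T), ∑ j, ⟪c j s, v⟫ ^ 2)
    (hconn : ∀ t ≥ (0 : ℝ), ∀ v : Fin n → ℝ, (∑ j, v j) = 0 →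
      lam * (∑ j, v j ^ 2) ≤ ∫ s in t..(t + T), v ⬝ᵥ ((L s) *ᵥ v)) :
    ∃ μ > (0 : ℝ), ∀ t ≥ (0 : ℝ), ∀ x : PiLp 2 (fun _ : Fin n => EuclideanSpace ℝ (Fin n)),
      μ * ‖x‖ ^ 2 ≤
        ∫ s in t..(t + T), ⟪x, consensusInnovationCLM α (L s) (fun j => c j s) x⟫ := by
  have hn0 : (0 : ℝ) < n := by exact_mod_cast hn
  set η := min (1 / 2) (α * lam / (4 * r₂ * T)) with hη
  have hη0 : 0 < η := by rw [hη]; positivity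
  have hη1 : η ≤ 1 / 2 := min_le_left _ _
  have hη2 : 2 * η * (r₂ * T) ≤ α * lam / 2 := by
    have h : η ≤ α * lam / (4 * r₂ * T) := min_le_right _ _
    rw [le_div_iff₀ (by positivity)] at h
    linarith
  refine ⟨min (α * lam / 2) (η * ιlo / n), by positivity, fun t ht x => ?_⟩
  set μ := min (α * lam / 2) (η * ιlo / n)
  have hμ1 : μ ≤ α * lam / 2 := min_le_left _ _
  have hμ2 : μ * n ≤ η * ιlo := by
    have h : μ ≤ η * ιlo / n := min_le_right _ _
    rwa [le_div_iff₀ hn0] at h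
  set m : EuclideanSpace ℝ (Fin n) := (n : ℝ)⁻¹ • ∑ j, x j with hm
  set Q := ∑ j, ‖x j - m‖ ^ 2 with hQ
  have hQ0 : 0 ≤ Q := by positivity
  have hsum : ∑ j, x j = (n : ℝ) • m := by
    rw [hm, smul_smul, mul_inv_cancel₀ hn0.ne', one_smul]
  have hnorm : ‖x‖ ^ 2 = n * ‖m‖ ^ 2 + Q := by
    have h : ∀ j, ‖x j - m‖ ^ 2 = ‖x j‖ ^ 2 - 2 * ⟪x j, m⟫ + ‖m‖ ^ 2 := fun j =>
      norm_sub_sq_real _ _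
    rw [PiLp.norm_sq_eq_of_L2, hQ, Finset.sum_congr rfl fun j _ => h j, Finset.sum_add_distrib,
      Finset.sum_sub_distrib, ← Finset.mul_sum, ← sum_inner, hsum, real_inner_smul_left,
      real_inner_self_eq_norm_sq]
    simp
    ring
  have hLu : ∀ u : Fin n → ℝ, Continuous fun s => u ⬝ᵥ (L s *ᵥ u) := fun u =>
    Continuous.dotProduct continuous_const (hLcont.matrix_mulVec continuous_const)
  have hcons : lam * Q ≤ ∫ s in t..(t + T), ∑ i, (fun j => x j i) ⬝ᵥ (L s *ᵥ fun j => x j i) := by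
    rw [intervalIntegral.integral_finsetSum fun i _ => (hLu _).intervalIntegrable _ _]
    have hQ' : Q = ∑ i, ∑ j, (x j i - m i) ^ 2 := by
      rw [hQ, Finset.sum_comm]
      refine Finset.sum_congr rfl fun j _ => ?_
      rw [EuclideanSpace.real_norm_sq_eq]
      rfl
    rw [hQ', Finset.mul_sum]
    refine Finset.sum_le_sum fun i _ => ?_
    have h := hconn t ht ((fun j => x j i) - fun _ => m i) ?_
    · simp only [mulVec_sub_const _ (hLsymm _) (hL1 _)] at h
      exact h
    · have h := congrArg (fun v : EuclideanSpace ℝ (Fin n) => v i) hsum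
      simp only [WithLp.ofLp_sum, Finset.sum_apply, PiLp.smul_apply, smul_eq_mul] at h
      simp [Finset.sum_sub_distrib, h]
  have hcv : ∀ v : EuclideanSpace ℝ (Fin n), Continuous fun s => ∑ j, ⟪c j s, v⟫ ^ 2 := by
    intro v
    fun_prop
  have hcx : Continuous fun s => ∑ j, ⟪c j s, x j⟫ * ⟪c j s, x j⟫ := by fun_prop
  have hinn : η * (ιlo * ‖m‖ ^ 2) - 2 * η * (r₂ * T) * Q ≤
      ∫ s in t..(t + T), ∑ j, ⟪c j s, x j⟫ * ⟪c j s, x j⟫ := by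
    have hpt : ∀ s ∈ Icc t (t + T), η * (∑ j, ⟪c j s, m⟫ ^ 2) - 2 * η * r₂ * Q ≤
        ∑ j, ⟪c j s, x j⟫ * ⟪c j s, x j⟫ := by
      intro s hs
      rw [hQ, Finset.mul_sum, Finset.mul_sum, ← Finset.sum_sub_distrib]
      refine Finset.sum_le_sum fun j _ => ?_
      have h1 := real_inner_mul_inner_self_le (c j s) (x j - m)
      rw [real_inner_self_eq_norm_sq, real_inner_self_eq_norm_sq] at h1
      have h2 := mul_le_mul_of_nonneg_right (hcbd j s (ht.le.trans hs.1)) (sq_nonneg ‖x j - m‖)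
      have h3 : ⟪c j s, x j⟫ = ⟪c j s, m⟫ + ⟪c j s, x j - m⟫ := by
        rw [← inner_add_right]; simp
      rw [h3]
      set a := ⟪c j s, m⟫
      set b := ⟪c j s, x j - m⟫
      have h4 := mul_le_mul_of_nonneg_left (h1.trans h2) (by positivity : 0 ≤ 2 * η)
      have h5 : 0 ≤ (1 - 2 * η) * ((a + b) * (a + b)) :=
        mul_nonneg (by linarith) (mul_self_nonneg _)
      have h6 : 0 ≤ η * ((a + 2 * b) * (a + 2 * b)) :=
        mul_nonneg hη0.le (mul_self_nonneg _)
      nlinarith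
    have h := integral_mono_on (μ := volume) (by linarith : t ≤ t + T)
      ((((hcv m).const_mul η).sub continuous_const).intervalIntegrable _ _)
      (hcx.intervalIntegrable _ _) hpt
    simp only [Pi.sub_apply] at h
    rw [intervalIntegral.integral_sub (((hcv m).const_mul η).intervalIntegrable _ _)
      (continuous_const.intervalIntegrable _ _), intervalIntegral.integral_const_mul,
      intervalIntegral.integral_const, smul_eq_mul] at h
    have h7 := mul_le_mul_of_nonneg_left (hPE t ht m) hη0.le
    linarith
  have hLx : Continuous fun s =>
      α * ∑ i, (fun j => x j i) ⬝ᵥ (L s *ᵥ fun j => x j i) :=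
    (continuous_finsetSum _ fun i _ => hLu fun j => x j i).const_mul α
  simp only [inner_consensusInnovationCLM]
  rw [intervalIntegral.integral_add (hLx.intervalIntegrable _ _)
    (hcx.intervalIntegrable _ _), intervalIntegral.integral_const_mul, hnorm]
  have k1 := mul_le_mul_of_nonneg_left hcons hα.le
  have k2 := mul_le_mul_of_nonneg_right hη2 hQ0
  have k3 := mul_le_mul_of_nonneg_right hμ1 hQ0
  have k4 := mul_le_mul_of_nonneg_right hμ2 (sq_nonneg ‖m‖)
  linarith

theorem HasDerivWithinAt.toLp_two {ι E : Type*} [Fintype ι] [NormedAddCommGroup E]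
    [NormedSpace ℝ E] {f : ι → ℝ → E} {f' : ι → E} {s : Set ℝ} {t : ℝ}
    (h : ∀ j, HasDerivWithinAt (f j) (f' j) s t) :
    HasDerivWithinAt (fun t => (WithLp.toLp 2 fun j => f j t : PiLp 2 fun _ : ι => E))
      (WithLp.toLp 2 f') s t :=
  (PiLp.continuousLinearEquiv 2 ℝ (fun _ : ι => E)).symm.hasFDerivAt.comp_hasDerivWithinAt t
    (hasDerivWithinAt_pi.2 h)

/-- Input-to-state stability of the C+I error dynamics with respect to additive
disturbances: under the standing assumptions there are `κ, γ, β > 0`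
(independent of the disturbance and of the initial condition) such that every
solution of the disturbed error dynamics with disturbance of size at most `δ`
satisfies `(Σ_j ‖θ̃_j(t)‖²)^{1/2} ≤ κ e^{−γt} (Σ_j ‖θ̃_j(0)‖²)^{1/2} + β δ`. -/
theorem stmt_5
    (n : ℕ) (hn : 1 ≤ n)
    (α r₁ r₂ r₃ T ιlo ιhi lam : ℝ)
    (hα : 0 < α) (hr₁ : 0 < r₁) (hr₂ : 0 < r₂) (hr₃ : 0 < r₃)
    (hT : 0 < T) (hιlo : 0 < ιlo) (hιord : ιlo ≤ ιhi) (hlam : 0 < lam)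
    (Γ : Fin n → (EuclideanSpace ℝ (Fin n) →L[ℝ] EuclideanSpace ℝ (Fin n)))
    (c : Fin n → ℝ → EuclideanSpace ℝ (Fin n))
    (L : ℝ → Matrix (Fin n) (Fin n) ℝ)
    -- gains: symmetric, positive definite, bounded
    (hΓsymm : ∀ j, ∀ v w, ⟪Γ j v, w⟫ = ⟪v, Γ j w⟫)
    (hΓpos : ∀ j, ∀ v, v ≠ 0 → 0 < ⟪v, Γ j v⟫)
    (hΓbd : ∀ j, ‖Γ j‖ ≤ r₁)
    -- regressors: continuous and bounded
    (hccont : ∀ j, Continuous (c j))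
    (hcbd : ∀ j, ∀ t ≥ (0 : ℝ), ‖c j t‖ ^ 2 ≤ r₂)
    -- Laplacians: continuous, symmetric, positive semidefinite, L 𝟙 = 0, bounded
    (hLcont : Continuous L)
    (hLsymm : ∀ t, (L t).IsSymm)
    (hLpsd : ∀ t, (L t).PosSemidef)
    (hL1 : ∀ t, (L t) *ᵥ (fun _ => (1 : ℝ)) = 0)
    (hLbd : ∀ t ≥ (0 : ℝ), ‖Matrix.toEuclideanCLM (𝕜 := ℝ) (L t)‖ ≤ r₃)
    -- cooperative persistency of excitation
    (hPE : ∀ t ≥ T, ∀ v : EuclideanSpace ℝ (Fin n),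
      ιlo * ‖v‖ ^ 2 ≤ (∫ s in (t - T)..t, ∑ j, ⟪c j s, v⟫ ^ 2) ∧
        (∫ s in (t - T)..t, ∑ j, ⟪c j s, v⟫ ^ 2) ≤ ιhi * ‖v‖ ^ 2)
    -- connectivity on average
    (hconn : ∀ t ≥ T, ∀ v : Fin n → ℝ, (∑ j, v j) = 0 →
      lam * (∑ j, v j ^ 2) ≤ ∫ s in (t - T)..t, v ⬝ᵥ ((L s) *ᵥ v)) :
    ∃ κ > (0 : ℝ), ∃ γ > (0 : ℝ), ∃ β > (0 : ℝ),
      ∀ (θ : EuclideanSpace ℝ (Fin n)) (δ : ℝ)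
        (d : Fin n → ℝ → EuclideanSpace ℝ (Fin n))
        (θtil : Fin n → ℝ → EuclideanSpace ℝ (Fin n)),
        (∀ j, Continuous (d j)) →
        (∀ t ≥ (0 : ℝ), Real.sqrt (∑ j, ‖d j t‖ ^ 2) ≤ δ) →
        -- disturbed C+I error dynamics
        (∀ j, ∀ t ≥ (0 : ℝ), HasDerivWithinAt (θtil j)
          (-(α • Γ j (∑ k, L t j k • θtil k t))
            - Γ j ((⟪c j t, θtil j t⟫) • c j t) + d j t) (Ici 0) t) →
        ∀ t ≥ (0 : ℝ),
          Real.sqrt (∑ j, ‖θtil j t‖ ^ 2)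
            ≤ κ * Real.exp (-γ * t) * Real.sqrt (∑ j, ‖θtil j 0‖ ^ 2) + β * δ := by
  obtain ⟨μ, hμ, hμPE⟩ := exists_persistent_excitation hn hα hr₂ hT hιlo hlam c L hccont hcbd
    hLcont hLsymm hL1
    (fun t ht v => by
      simpa only [add_sub_cancel_right] using (hPE (t + T) (by linarith) v).1)
    (fun t ht v hv => by
      simpa only [add_sub_cancel_right] using hconn (t + T) (by linarith) v hv)
  have hnormsq : ∀ y : Fin n → EuclideanSpace ℝ (Fin n),
      ‖(WithLp.toLp 2 y : PiLp 2 (fun _ : Fin n => EuclideanSpace ℝ (Fin n)))‖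
        = Real.sqrt (∑ j, ‖y j‖ ^ 2) := fun y => PiLp.norm_eq_of_L2 _
  obtain ⟨κ, hκ, γ, hγ, β, hβ, hiss⟩ := exists_iss_estimate (blockDiagonalCLM Γ)
    (fun t => consensusInnovationCLM α (L t) fun j => c j t) (g := r₁) (M := α * r₃ + r₂)
    (T := T) (μ := μ) hr₁ (by positivity) hT hμ
    (fun v w => by
      rw [PiLp.inner_apply, PiLp.inner_apply]
      exact Finset.sum_congr rfl fun j _ => hΓsymm j _ _)
    (fun v hv => by
      obtain ⟨j, hj⟩ : ∃ j, v j ≠ 0 := by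
        by_contra! h
        exact hv (by ext j : 1; simpa using h j)
      rw [PiLp.inner_apply]
      refine Finset.sum_pos' (fun k _ => ?_) ⟨j, Finset.mem_univ j, hΓpos j _ hj⟩
      rcases eq_or_ne (v k) 0 with hk | hk
      · simp [hk]
      · exact (hΓpos k _ hk).le)
    (fun v => by
      refine abs_le_of_sq_le_sq' ?_ (by positivity) |>.2
      rw [mul_pow, PiLp.norm_sq_eq_of_L2, PiLp.norm_sq_eq_of_L2, Finset.mul_sum]
      refine Finset.sum_le_sum fun j _ => ?_
      rw [← mul_pow]
      exact pow_le_pow_left₀ (norm_nonneg _) ((Γ j).le_of_opNorm_le (hΓbd j) _) 2)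
    (continuous_consensusInnovationCLM α hLcont hccont)
    (fun t v w => by
      rw [real_inner_comm, inner_consensusInnovationCLM, inner_consensusInnovationCLM]
      congr 1
      · congr 1
        refine Finset.sum_congr rfl fun i _ => ?_
        rw [Matrix.dotProduct_mulVec, ← Matrix.mulVec_transpose, (hLsymm t).eq, dotProduct_comm]
      · exact Finset.sum_congr rfl fun j _ => mul_comm _ _)
    (fun t v => by
      rw [inner_consensusInnovationCLM]
      refine add_nonneg (mul_nonneg hα.le (Finset.sum_nonneg fun i _ => ?_))
        (Finset.sum_nonneg fun j _ => mul_self_nonneg _)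
      simpa using (hLpsd t).dotProduct_mulVec_nonneg fun j => v j i)
    (fun t ht v => inner_consensusInnovationCLM_le hα.le (L t) (fun j => c j t)
      (fun j => hcbd j t ht) (hLbd t ht) v)
    hμPE
  refine ⟨κ, hκ, γ, hγ, β, hβ, fun _ δ d θtil _ hdbd hdyn t ht => ?_⟩
  have h := hiss δ (fun t => WithLp.toLp 2 fun j => d j t) (fun t => WithLp.toLp 2 fun j => θtil j t)
    (fun t ht => by rw [hnormsq]; exact hdbd t ht) ?_ t ht
  · simpa only [hnormsq] using h
  · intro t ht
    refine (HasDerivWithinAt.toLp_two fun j => hdyn j t ht).congr_deriv (PiLp.ext fun j => ?_)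
    simp only [PiLp.add_apply, PiLp.neg_apply, blockDiagonalCLM_apply,
      consensusInnovationCLM_apply, map_add, map_smul]
    abel
end

section
/- Under the standing assumptions (bounds, cooperative persistency of excitation, connectivity on average), and assuming additionally that every component of the true parameter vector is positive, i.e. θ_i > 0 for all i (so that θ_i = ω_s/(2H_i) for inertia constants H_i := ω_s/(2θ_i) > 0, with ω_s > 0 given), the following holds: for every differentiable family θ̂_1, …, θ̂_n : [0,∞) → ℝⁿ satisfying the C+I update θ̂_j'(t) = −α Γ_j (Σ_k L(t)_{jk} θ̂_k(t)) − Γ_j c_j(t)(c_j(t)ᵀθ̂_j(t) − y_j(t)) with y_j(t) = c_j(t)ᵀθ, each control area's local total-inertia estimate Ĥ_j^{tot}(t) := (ω_s/2) Σ_{i=1}^{n} 1/(θ̂_j(t))_i converges, as t → ∞, to the true total inertia H^{tot} = Σ_{i=1}^{n} H_i; i.e., every control area asymptotically reconstructs the total inertia of the interconnected power system from purely local measurements and peer-to-peer exchange of parameter estimates. -/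
open Set MeasureTheory intervalIntegral RealInnerProductSpace Filter
open scoped Matrix

theorem intervalIntegrable_of_continuousOn_Ici {E : Type*} [NormedAddCommGroup E] {f : ℝ → E}
    {a b x : ℝ} (ha : x ≤ a) (hab : a ≤ b) (hf : ContinuousOn f (Ici x)) :
    IntervalIntegrable f volume a b :=
  (hf.mono ((uIcc_of_le hab).subset.trans fun _ hs => ha.trans hs.1)).intervalIntegrable

theorem sq_intervalIntegral_le {a b : ℝ} (hab : a ≤ b) {g : ℝ → ℝ}
    (hg : ContinuousOn g (Icc a b)) :
    (∫ s in a..b, g s) ^ 2 ≤ (b - a) * ∫ s in a..b, g s ^ 2 := by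
  rcases hab.eq_or_lt with rfl | hlt
  · simp
  have hgi : IntervalIntegrable g volume a b :=
    (hg.mono (uIcc_of_le hab).subset).intervalIntegrable
  have hgi2 : IntervalIntegrable (fun s => g s ^ 2) volume a b :=
    ((hg.pow 2).mono (uIcc_of_le hab).subset).intervalIntegrable
  set I := ∫ s in a..b, g s with hI
  set m := I / (b - a) with hm
  have h0 : 0 ≤ ∫ s in a..b, (g s - m) ^ 2 :=
    integral_nonneg hab fun s _ => sq_nonneg _
  have h1 : ∫ s in a..b, (g s - m) ^ 2
      = (∫ s in a..b, g s ^ 2) - 2 * m * I + m ^ 2 * (b - a) := by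
    have : (fun s => (g s - m) ^ 2) = fun s => (g s ^ 2 - 2 * m * g s) + m ^ 2 := by
      ext s; ring
    rw [this, integral_add (hgi2.sub (hgi.const_mul _)) (by simp),
      integral_sub hgi2 (hgi.const_mul _), intervalIntegral.integral_const_mul]
    simp [hI]; ring
  have hpos : 0 < b - a := sub_pos.2 hlt
  have hmI : m * (b - a) = I := by rw [hm]; field_simp
  rw [h1] at h0
  have := mul_nonneg hpos.le h0
  nlinarith

theorem norm_sq_apply_le_of_psd {H : Type*} [NormedAddCommGroup H] [InnerProductSpace ℝ H]
    {B : H →L[ℝ] H} {r : ℝ} (hr : 0 < r) (hsymm : ∀ v w, ⟪B v, w⟫ = ⟪v, B w⟫)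
    (hpos : ∀ v, 0 ≤ ⟪v, B v⟫) (hB : ‖B‖ ≤ r) (v : H) :
    ‖B v‖ ^ 2 ≤ r * ⟪v, B v⟫ := by
  have h := hpos (r • v - B v)
  have h1 : ⟪B v, B (B v)⟫ ≤ r * ‖B v‖ ^ 2 := by
    calc ⟪B v, B (B v)⟫ ≤ ‖B v‖ * ‖B (B v)‖ := real_inner_le_norm _ _
      _ ≤ ‖B v‖ * (r * ‖B v‖) := by
        gcongr
        exact B.le_of_opNorm_le hB _
      _ = r * ‖B v‖ ^ 2 := by ring
  have h2 : ⟪r • v - B v, B (r • v - B v)⟫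
      = r ^ 2 * ⟪v, B v⟫ - 2 * r * ‖B v‖ ^ 2 + ⟪B v, B (B v)⟫ := by
    simp only [map_sub, map_smul, inner_sub_left, inner_sub_right, inner_smul_left,
      inner_smul_right, real_inner_self_eq_norm_sq, ← hsymm v (B v)]
    simp; ring
  rw [h2] at h
  have h3 : 0 ≤ r * (r * ⟪v, B v⟫ - ‖B v‖ ^ 2) := by nlinarith
  linarith [nonneg_of_mul_nonneg_right h3 hr]

theorem exists_symm_psd_leftInverse {H : Type*} [NormedAddCommGroup H] [InnerProductSpace ℝ H]
    [FiniteDimensional ℝ H] {G : H →L[ℝ] H} (hsymm : ∀ v w, ⟪G v, w⟫ = ⟪v, G w⟫)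
    (hpos : ∀ v, v ≠ 0 → 0 < ⟪v, G v⟫) :
    ∃ P : H →L[ℝ] H, (∀ v w, ⟪P v, w⟫ = ⟪v, P w⟫) ∧ (∀ v, 0 ≤ ⟪v, P v⟫) ∧ ∀ v, P (G v) = v := by
  have hinj : Function.Injective (G : H →ₗ[ℝ] H) := by
    rw [← LinearMap.ker_eq_bot, LinearMap.ker_eq_bot']
    intro v hv
    by_contra hne
    have := hpos v hne
    have hv' : G v = 0 := hv
    simp [hv'] at this
  let F := LinearEquiv.ofInjectiveEndo (G : H →ₗ[ℝ] H) hinj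
  have hF : ∀ v, F v = G v := fun v => rfl
  have hGP : ∀ v, G (F.symm v) = v := fun v => by rw [← hF]; simp
  have hs : ∀ v w, ⟪F.symm v, w⟫ = ⟪v, F.symm w⟫ := fun v w => by
    conv_lhs => rw [← hGP w, ← hsymm, hGP]
  refine ⟨LinearMap.toContinuousLinearMap (F.symm : H →ₗ[ℝ] H), hs, fun v => ?_, fun v => ?_⟩
  · change 0 ≤ ⟪v, F.symm v⟫
    have hv : ⟪v, F.symm v⟫ = ⟪F.symm v, G (F.symm v)⟫ := by rw [hGP, real_inner_comm]
    rw [hv]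
    rcases eq_or_ne (F.symm v) 0 with h | h
    · simp [h]
    · exact (hpos _ h).le
  · change F.symm (G v) = v
    rw [← hF]; simp

theorem tendsto_zero_of_persistently_excited_flow {H : Type*} [NormedAddCommGroup H]
    [InnerProductSpace ℝ H] [FiniteDimensional ℝ H] {G : H →L[ℝ] H} {A : ℝ → H →L[ℝ] H}
    {r M T μ : ℝ} (hM : 0 ≤ M) (hT : 0 < T) (hμ : 0 < μ)
    (hGsymm : ∀ v w, ⟪G v, w⟫ = ⟪v, G w⟫) (hGpos : ∀ v, v ≠ 0 → 0 < ⟪v, G v⟫)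
    (hG : ‖G‖ ≤ r) (hAcont : Continuous A)
    (hAsymm : ∀ t v w, ⟪A t v, w⟫ = ⟪v, A t w⟫)
    (hApos : ∀ t v, 0 ≤ ⟪v, A t v⟫)
    (hA : ∀ t, 0 ≤ t → ∀ v, ‖A t v‖ ^ 2 ≤ M * ⟪v, A t v⟫)
    (hPE : ∀ t, T ≤ t → ∀ v, μ * ‖v‖ ^ 2 ≤ ∫ s in (t - T)..t, ⟪v, A s v⟫)
    {e : ℝ → H}
    (he : ∀ t, 0 ≤ t → HasDerivWithinAt e (-(G (A t (e t)))) (Ici 0) t) :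
    Tendsto e atTop (nhds 0) := by
  obtain ⟨P, hPsymm, hPpos, hPG⟩ := exists_symm_psd_leftInverse hGsymm hGpos
  have hr : 0 ≤ r := (norm_nonneg _).trans hG
  have hec : ContinuousOn e (Ici 0) := fun t ht => (he t ht).continuousWithinAt
  have hAec : ContinuousOn (fun s => A s (e s)) (Ici 0) :=
    hAcont.continuousOn.clm_apply hec
  set q : ℝ → ℝ := fun s => ⟪e s, A s (e s)⟫ with hq
  have hqc : ContinuousOn q (Ici 0) := hec.inner hAec
  set V : ℝ → ℝ := fun s => ⟪e s, P (e s)⟫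
  have hVd : ∀ t, 0 ≤ t → HasDerivWithinAt V (-2 * q t) (Ici 0) t := fun t ht => by
    have h := (he t ht).inner ℝ (P.hasFDerivAt.comp_hasDerivWithinAt t (he t ht))
    refine h.congr_deriv ?_
    rw [map_neg, hPG, inner_neg_left, inner_neg_right, Function.comp_apply]
    rw [← hPsymm (G _), hPG, real_inner_comm (e t) (A t (e t))]
    ring
  have hsub : ∀ {a b : ℝ}, 0 ≤ a → Icc a b ⊆ Ici 0 := fun ha s hs => ha.trans hs.1
  have hftc : ∀ a b : ℝ, 0 ≤ a → a ≤ b → ∫ s in a..b, q s = (V a - V b) / 2 := by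
    intro a b ha hab
    have h := integral_eq_sub_of_hasDerivAt_of_le hab
      (fun s hs => ((hVd s (hsub ha hs)).continuousWithinAt).mono (hsub ha))
      (fun s hs => (hVd s (ha.trans hs.1.le)).hasDerivAt (Ici_mem_nhds (ha.trans_lt hs.1)))
      (intervalIntegrable_of_continuousOn_Ici ha hab (continuousOn_const.mul hqc))
    rw [intervalIntegral.integral_const_mul] at h
    linarith
  have hqnn : ∀ s, 0 ≤ q s := fun s => hApos s _
  have hVanti : ∀ a b : ℝ, 0 ≤ a → a ≤ b → V b ≤ V a := fun a b ha hab => by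
    have h1 := hftc a b ha hab
    have h2 : 0 ≤ ∫ s in a..b, q s := integral_nonneg hab fun s _ => hqnn s
    linarith
  obtain ⟨l, hl⟩ : ∃ l, Tendsto V atTop (nhds l) := by
    have hanti : Antitone fun t => V (max t 0) := fun a b hab =>
      hVanti _ _ (le_max_right _ _) (max_le_max_right _ hab)
    refine ⟨_, (tendsto_atTop_ciInf hanti ⟨0, ?_⟩).congr' ?_⟩
    · rintro _ ⟨t, rfl⟩
      exact hPpos _
    · filter_upwards [eventually_ge_atTop 0] with t ht
      rw [max_eq_left ht]
  have hwin : Tendsto (fun t => (V (t - T) - V t) / 2) atTop (nhds 0) := by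
    simpa [← sub_eq_add_neg] using ((hl.comp (tendsto_atTop_add_const_right _ (-T) tendsto_id)).sub hl).div_const 2
  have hdrift : ∀ t s, T ≤ t → s ∈ Icc (t - T) t →
      ‖e t - e s‖ ^ 2 ≤ T * (r ^ 2 * M * ∫ s in (t - T)..t, q s) := by
    intro t s ht hs
    have h0 : 0 ≤ t - T := sub_nonneg.2 ht
    have hs0 : 0 ≤ s := h0.trans hs.1
    have hGAc : ContinuousOn (fun s => -(G (A s (e s)))) (Ici 0) :=
      (G.continuous.comp_continuousOn hAec).neg
    have h1 : ∫ u in s..t, -(G (A u (e u))) = e t - e s :=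
      integral_eq_sub_of_hasDerivAt_of_le hs.2 (hec.mono (hsub hs0))
        (fun u hu => (he u (hs0.trans hu.1.le)).hasDerivAt (Ici_mem_nhds (hs0.trans_lt hu.1)))
        (intervalIntegrable_of_continuousOn_Ici hs0 hs.2 hGAc)
    have h2 : ‖e t - e s‖ ≤ ∫ u in s..t, ‖-(G (A u (e u)))‖ := by
      rw [← h1]
      exact norm_integral_le_integral_norm hs.2
    have hnn : 0 ≤ ∫ s in s..t, q s := integral_nonneg hs.2 fun s _ => hqnn s
    calc ‖e t - e s‖ ^ 2 ≤ (∫ u in s..t, ‖-(G (A u (e u)))‖) ^ 2 := by gcongr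
      _ ≤ (t - s) * ∫ u in s..t, ‖-(G (A u (e u)))‖ ^ 2 :=
        sq_intervalIntegral_le hs.2 (hGAc.norm.mono (hsub hs0))
      _ ≤ (t - s) * ∫ u in s..t, r ^ 2 * M * q u := by
        gcongr
        · linarith [hs.2]
        · refine integral_mono_on hs.2
            (intervalIntegrable_of_continuousOn_Ici hs0 hs.2 (hGAc.norm.pow 2))
            (intervalIntegrable_of_continuousOn_Ici hs0 hs.2 (continuousOn_const.mul hqc)) fun u hu => ?_
          rw [norm_neg]
          calc ‖G (A u (e u))‖ ^ 2 ≤ (r * ‖A u (e u)‖) ^ 2 := by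
                gcongr
                exact G.le_of_opNorm_le hG _
            _ = r ^ 2 * ‖A u (e u)‖ ^ 2 := by ring
            _ ≤ r ^ 2 * (M * q u) := by
                gcongr
                exact hA u (hs0.trans hu.1) _
            _ = r ^ 2 * M * q u := by ring
      _ = (t - s) * (r ^ 2 * M * ∫ u in s..t, q u) := by
        rw [intervalIntegral.integral_const_mul]
      _ ≤ T * (r ^ 2 * M * ∫ s in (t - T)..t, q s) := by
        gcongr ?_ * (_ * ?_)
        · linarith [hs.1]
        · exact integral_mono_interval hs.1 hs.2 le_rfl (ae_of_all _ hqnn)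
            (intervalIntegrable_of_continuousOn_Ici h0 (by linarith) hqc)
  have hApply : ∀ t, 0 ≤ t → ∀ v, ⟪v, A t v⟫ ≤ M * ‖v‖ ^ 2 := by
    intro t ht v
    have h1 := hA t ht v
    have h2 := real_inner_le_norm v (A t v)
    have h3 := hApos t v
    rcases h3.eq_or_lt with h | h
    · rw [← h]; positivity
    · refine le_of_mul_le_mul_right ?_ h
      calc ⟪v, A t v⟫ * ⟪v, A t v⟫ ≤ (‖v‖ * ‖A t v‖) * (‖v‖ * ‖A t v‖) := by gcongr
        _ = ‖v‖ ^ 2 * ‖A t v‖ ^ 2 := by ring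
        _ ≤ ‖v‖ ^ 2 * (M * ⟪v, A t v⟫) := by gcongr
        _ = M * ‖v‖ ^ 2 * ⟪v, A t v⟫ := by ring
  have hsplit : ∀ t v w, ⟪v, A t v⟫ ≤ 2 * ⟪w, A t w⟫ + 2 * ⟪v - w, A t (v - w)⟫ := by
    intro t v w
    have h := hApos t ((2 : ℝ) • w - v)
    have hc : ⟪w, A t v⟫ = ⟪v, A t w⟫ := by rw [← hAsymm, real_inner_comm]
    simp only [map_sub, map_smul, inner_sub_left, inner_sub_right, inner_smul_left,
      inner_smul_right, hc] at h ⊢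
    simp at h
    linarith
  have hbound : ∀ t, T ≤ t → ‖e t‖ ^ 2 ≤
      (2 + 2 * M * T * T * r ^ 2 * M) / μ * ((V (t - T) - V t) / 2) := by
    intro t ht
    have h0 : 0 ≤ t - T := sub_nonneg.2 ht
    have hle : t - T ≤ t := by linarith
    rw [← hftc _ _ h0 hle]
    set δ := ∫ s in (t - T)..t, q s with hδ
    have key : μ * ‖e t‖ ^ 2 ≤ 2 * δ + T * (2 * M * (T * (r ^ 2 * M * δ))) := by
      calc μ * ‖e t‖ ^ 2 ≤ ∫ s in (t - T)..t, ⟪e t, A s (e t)⟫ := hPE t ht _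
        _ ≤ ∫ s in (t - T)..t, (2 * q s + 2 * M * (T * (r ^ 2 * M * δ))) := by
          refine integral_mono_on hle (Continuous.intervalIntegrable (by fun_prop) _ _)
            (intervalIntegrable_of_continuousOn_Ici h0 hle (by fun_prop)) fun s hs => ?_
          refine (hsplit s (e t) (e s)).trans ?_
          have h1 := hApply s (h0.trans hs.1) (e t - e s)
          have h2 := mul_le_mul_of_nonneg_left (hdrift t s ht hs) hM
          simp only [hq]
          linarith
        _ = 2 * δ + T * (2 * M * (T * (r ^ 2 * M * δ))) := by
          rw [integral_add (intervalIntegrable_of_continuousOn_Ici h0 hle (by fun_prop)) (by simp),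
            intervalIntegral.integral_const_mul]
          simp only [intervalIntegral.integral_const, sub_sub_cancel, smul_eq_mul, hδ]
    rw [div_mul_eq_mul_div, le_div_iff₀ hμ]
    linarith
  have hsq : Tendsto (fun t => ‖e t‖ ^ 2) atTop (nhds 0) := by
    refine squeeze_zero' (Eventually.of_forall fun t => sq_nonneg _)
      ((eventually_ge_atTop T).mono hbound) ?_
    simpa using hwin.const_mul ((2 + 2 * M * T * T * r ^ 2 * M) / μ)
  rw [tendsto_zero_iff_norm_tendsto_zero]
  simpa [Real.sqrt_sq (norm_nonneg _)] using hsq.sqrt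

/-- The block-diagonal operator with blocks `Γ j`. -/
noncomputable def blockDiagCLM {ι E : Type*} [Fintype ι] [NormedAddCommGroup E]
    [InnerProductSpace ℝ E] (Γ : ι → E →L[ℝ] E) :
    PiLp 2 (fun _ : ι => E) →L[ℝ] PiLp 2 (fun _ : ι => E) :=
  (PiLp.continuousLinearEquiv 2 ℝ (fun _ : ι => E)).symm.toContinuousLinearMap ∘L
    ContinuousLinearMap.pi fun j => Γ j ∘L PiLp.proj 2 (fun _ : ι => E) j

theorem blockDiagCLM_apply {ι E : Type*} [Fintype ι] [NormedAddCommGroup E]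
    [InnerProductSpace ℝ E] (Γ : ι → E →L[ℝ] E) (x : PiLp 2 (fun _ : ι => E)) (j : ι) :
    blockDiagCLM Γ x j = Γ j (x j) := rfl

theorem norm_blockDiagCLM_le {ι E : Type*} [Fintype ι] [NormedAddCommGroup E]
    [InnerProductSpace ℝ E] {Γ : ι → E →L[ℝ] E} {r : ℝ} (hr : 0 ≤ r) (hΓ : ∀ j, ‖Γ j‖ ≤ r) :
    ‖blockDiagCLM Γ‖ ≤ r := by
  refine ContinuousLinearMap.opNorm_le_bound _ hr fun x => ?_
  refine le_of_sq_le_sq ?_ (by positivity)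
  rw [mul_pow, PiLp.norm_sq_eq_of_L2, PiLp.norm_sq_eq_of_L2, Finset.mul_sum]
  refine Finset.sum_le_sum fun j _ => ?_
  rw [← mul_pow, blockDiagCLM_apply]
  gcongr
  exact (Γ j).le_of_opNorm_le (hΓ j) _

/-- The consensus+innovations operator
`x ↦ (α ∑ₖ Lⱼₖ xₖ + ⟪cⱼ, xⱼ⟫ cⱼ)ⱼ` on the stacked estimates. -/
noncomputable def consensusInnovation {ι E : Type*} [Fintype ι] [NormedAddCommGroup E]
    [InnerProductSpace ℝ E] (α : ℝ) (L : Matrix ι ι ℝ) (c : ι → E) :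
    PiLp 2 (fun _ : ι => E) →L[ℝ] PiLp 2 (fun _ : ι => E) :=
  (PiLp.continuousLinearEquiv 2 ℝ (fun _ : ι => E)).symm.toContinuousLinearMap ∘L
    ContinuousLinearMap.pi fun j =>
      α • ∑ k, L j k • PiLp.proj 2 (fun _ : ι => E) k +
        (innerSL ℝ (c j) ∘L PiLp.proj 2 (fun _ : ι => E) j).smulRight (c j)

theorem consensusInnovation_apply {ι E : Type*} [Fintype ι] [NormedAddCommGroup E]
    [InnerProductSpace ℝ E] (α : ℝ) (L : Matrix ι ι ℝ) (c : ι → E)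
    (x : PiLp 2 (fun _ : ι => E)) (j : ι) :
    consensusInnovation α L c x j = α • (∑ k, L j k • x k) + ⟪c j, x j⟫ • c j := by
  simp [consensusInnovation]

theorem inner_consensusInnovation {ι κ : Type*} [Fintype ι] [Fintype κ] (α : ℝ)
    (L : Matrix ι ι ℝ) (c : ι → EuclideanSpace ℝ κ)
    (x y : PiLp 2 (fun _ : ι => EuclideanSpace ℝ κ)) :
    ⟪x, consensusInnovation α L c y⟫ =
      α * ∑ i, (fun j => x j i) ⬝ᵥ (L *ᵥ fun j => y j i) + ∑ j, ⟪c j, x j⟫ * ⟪c j, y j⟫ := by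
  rw [PiLp.inner_apply]
  simp only [consensusInnovation_apply, inner_add_right, inner_smul_right, Finset.sum_add_distrib]
  congr 1
  · rw [← Finset.mul_sum]
    congr 1
    simp only [PiLp.inner_apply, dotProduct, Matrix.mulVec]
    rw [Finset.sum_comm]
    simp [mul_comm]
  · exact Finset.sum_congr rfl fun j _ => by rw [real_inner_comm (c j) (x j), mul_comm]

theorem norm_sq_consensusInnovation_le {ι κ : Type*} [Fintype ι] [DecidableEq ι] [Fintype κ]
    {α r₂ r₃ : ℝ} (hα : 0 ≤ α) (hr₃ : 0 < r₃) {L : Matrix ι ι ℝ} {c : ι → EuclideanSpace ℝ κ}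
    (hL : L.PosSemidef) (hLbd : ‖Matrix.toEuclideanCLM (𝕜 := ℝ) L‖ ≤ r₃)
    (hc : ∀ j, ‖c j‖ ^ 2 ≤ r₂) (hr₂ : 0 ≤ r₂)
    (x : PiLp 2 (fun _ : ι => EuclideanSpace ℝ κ)) :
    ‖consensusInnovation α L c x‖ ^ 2 ≤
      (2 * α * r₃ + 2 * r₂) * ⟪x, consensusInnovation α L c x⟫ := by
  have hinner : ∀ v w : EuclideanSpace ℝ ι,
      ⟪v, Matrix.toEuclideanCLM (𝕜 := ℝ) L w⟫ = v.ofLp ⬝ᵥ (L *ᵥ w.ofLp) := fun v w => by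
    simp [PiLp.inner_apply, dotProduct, mul_comm]
  have hsymm : L.IsSymm := by simpa [Matrix.IsHermitian, Matrix.IsSymm] using hL.isHermitian
  have hcol : ∀ v : ι → ℝ, ∑ j, (L *ᵥ v) j ^ 2 ≤ r₃ * (v ⬝ᵥ (L *ᵥ v)) := by
    intro v
    have h := norm_sq_apply_le_of_psd (B := Matrix.toEuclideanCLM (𝕜 := ℝ) L) hr₃
      (fun v w => by
        rw [real_inner_comm, hinner, hinner, Matrix.dotProduct_mulVec, ← Matrix.mulVec_transpose,
          hsymm.eq, dotProduct_comm])
      (fun v => by rw [hinner]; simpa using hL.dotProduct_mulVec_nonneg v.ofLp) hLbd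
      (WithLp.toLp 2 v)
    rw [hinner, EuclideanSpace.norm_sq_eq] at h
    simpa using h
  have hcons : ∑ j, ‖∑ k, L j k • x k‖ ^ 2 ≤
      r₃ * ∑ i, (fun j => x j i) ⬝ᵥ (L *ᵥ fun j => x j i) := by
    simp only [EuclideanSpace.norm_sq_eq]
    rw [Finset.sum_comm, Finset.mul_sum]
    refine Finset.sum_le_sum fun i _ => ?_
    simpa [Matrix.mulVec, dotProduct] using hcol fun j => x j i
  have hnn : 0 ≤ ∑ i, (fun j => x j i) ⬝ᵥ (L *ᵥ fun j => x j i) :=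
    Finset.sum_nonneg fun i _ => by simpa using hL.dotProduct_mulVec_nonneg fun j => x j i
  have hinn : ∑ j, ‖⟪c j, x j⟫ • c j‖ ^ 2 ≤ r₂ * ∑ j, ⟪c j, x j⟫ * ⟪c j, x j⟫ := by
    rw [Finset.mul_sum]
    refine Finset.sum_le_sum fun j _ => ?_
    rw [norm_smul, mul_pow, Real.norm_eq_abs, sq_abs]
    nlinarith [hc j, sq_nonneg ⟪c j, x j⟫]
  have hnn' : 0 ≤ ∑ j, ⟪c j, x j⟫ * ⟪c j, x j⟫ :=
    Finset.sum_nonneg fun j _ => mul_self_nonneg _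
  have hsum : ‖consensusInnovation α L c x‖ ^ 2 ≤
      2 * α ^ 2 * ∑ j, ‖∑ k, L j k • x k‖ ^ 2 + 2 * ∑ j, ‖⟪c j, x j⟫ • c j‖ ^ 2 := by
    rw [PiLp.norm_sq_eq_of_L2, Finset.mul_sum, Finset.mul_sum, ← Finset.sum_add_distrib]
    refine Finset.sum_le_sum fun j _ => ?_
    rw [consensusInnovation_apply]
    have h := parallelogram_law_with_norm ℝ (α • (∑ k, L j k • x k)) (⟪c j, x j⟫ • c j)
    have h' : ‖α • (∑ k, L j k • x k)‖ * ‖α • (∑ k, L j k • x k)‖ =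
        α ^ 2 * ‖∑ k, L j k • x k‖ ^ 2 := by
      rw [← sq, norm_smul, mul_pow, Real.norm_eq_abs, sq_abs]
    nlinarith [mul_self_nonneg ‖α • (∑ k, L j k • x k) - ⟪c j, x j⟫ • c j‖]
  rw [inner_consensusInnovation]
  have h1 := mul_le_mul_of_nonneg_left hcons (by positivity : 0 ≤ 2 * α ^ 2)
  have h2 : 0 ≤ α * r₃ * ∑ j, ⟪c j, x j⟫ * ⟪c j, x j⟫ := by positivity
  have h3 : 0 ≤ r₂ * (α * ∑ i, (fun j => x j i) ⬝ᵥ (L *ᵥ fun j => x j i)) := by positivity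
  nlinarith

theorem continuous_consensusInnovation {ι κ : Type*} [Fintype ι] [Fintype κ] {α : ℝ}
    {L : ℝ → Matrix ι ι ℝ} {c : ι → ℝ → EuclideanSpace ℝ κ} (hL : Continuous L)
    (hc : ∀ j, Continuous (c j)) :
    Continuous fun t => consensusInnovation α (L t) fun j => c j t := by
  rw [continuous_clm_apply]
  intro x
  refine (PiLp.continuous_toLp 2 _).comp (continuous_pi fun j => ?_)
  have : Continuous fun t => α • (∑ k, L t j k • x k) + ⟪c j t, x j⟫ • c j t := by
    have := hc j
    have : ∀ k, Continuous fun t => L t j k := fun k => hL.matrix_elem j k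
    fun_prop
  simpa [← consensusInnovation_apply] using this

/-- Joint excitation: persistency of excitation on the consensus subspace together with
connectivity on its complement. -/
theorem exists_pos_le_integral_consensusInnovation {ι κ : Type*} [Fintype ι] [Nonempty ι]
    [Fintype κ] {α r₂ T a lam : ℝ} (hα : 0 < α) (hr₂ : 0 ≤ r₂) (hT : 0 ≤ T) (ha : 0 < a)
    (hlam : 0 < lam) {L : ℝ → Matrix ι ι ℝ} {c : ι → ℝ → EuclideanSpace ℝ κ}
    (hL : Continuous L) (hc : ∀ j, Continuous (c j))
    (hcbd : ∀ j, ∀ t ≥ (0 : ℝ), ‖c j t‖ ^ 2 ≤ r₂)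
    (hLsymm : ∀ t, (L t).IsSymm) (hL1 : ∀ t, (L t) *ᵥ (fun _ => (1 : ℝ)) = 0)
    (hPE : ∀ t ≥ T, ∀ v : EuclideanSpace ℝ κ,
      a * ‖v‖ ^ 2 ≤ ∫ s in (t - T)..t, ∑ j, ⟪c j s, v⟫ ^ 2)
    (hconn : ∀ t ≥ T, ∀ v : ι → ℝ, (∑ j, v j) = 0 →
      lam * (∑ j, v j ^ 2) ≤ ∫ s in (t - T)..t, v ⬝ᵥ ((L s) *ᵥ v)) :
    ∃ μ > 0, ∀ t, T ≤ t → ∀ x : PiLp 2 (fun _ : ι => EuclideanSpace ℝ κ),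
      μ * ‖x‖ ^ 2 ≤ ∫ s in (t - T)..t, ⟪x, consensusInnovation α (L s) (fun j => c j s) x⟫ := by
  set N : ℝ := (Fintype.card ι : ℝ) with hN
  have hNpos : 0 < N := by positivity
  set K : ℝ := 2 * N * ((2 + 2 * r₂ * T / (α * lam)) / a) + 2 / (α * lam) with hK
  have hKpos : 0 < K := by positivity
  refine ⟨K⁻¹, inv_pos.2 hKpos, fun t ht x => ?_⟩
  set m : EuclideanSpace ℝ κ := N⁻¹ • ∑ j, x j with hm
  set y : ι → EuclideanSpace ℝ κ := fun j => x j - m with hy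
  have hysum : ∀ i, ∑ j, y j i = 0 := by
    intro i
    simp [hy, hm, ← hN]
    field_simp
    simp
  have hle : t - T ≤ t := by linarith
  set I := ∫ s in (t - T)..t, ⟪x, consensusInnovation α (L s) (fun j => c j s) x⟫ with hI
  have hLform : ∀ s i, (fun j => x j i) ⬝ᵥ (L s *ᵥ fun j => x j i) =
      (fun j => y j i) ⬝ᵥ (L s *ᵥ fun j => y j i) := by
    intro s i
    have hx : (fun j => x j i) = (fun j => y j i) + m i • (fun _ => (1 : ℝ)) := by
      ext j; simp [hy]
    have h1 : (fun _ => (1 : ℝ)) ᵥ* L s = 0 := by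
      rw [← Matrix.mulVec_transpose, (hLsymm s).eq, hL1]
    rw [hx, Matrix.mulVec_add, Matrix.mulVec_smul, hL1, smul_zero, add_zero, add_dotProduct,
      smul_dotProduct, Matrix.dotProduct_mulVec (fun _ => (1 : ℝ)), h1]
    simp
  have hLc : ∀ v : ι → ℝ, Continuous fun s => v ⬝ᵥ (L s *ᵥ v) := fun v => by fun_prop
  have hCc : ∀ v : ι → EuclideanSpace ℝ κ, Continuous fun s => ∑ j, ⟪c j s, v j⟫ ^ 2 := fun v => by
    fun_prop
  have hIeq : I = α * (∑ i, ∫ s in (t - T)..t, (fun j => y j i) ⬝ᵥ (L s *ᵥ fun j => y j i)) +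
      ∫ s in (t - T)..t, ∑ j, ⟪c j s, x j⟫ ^ 2 := by
    rw [hI]
    simp only [inner_consensusInnovation, hLform, ← sq]
    rw [intervalIntegral.integral_add, intervalIntegral.integral_const_mul,
      intervalIntegral.integral_finsetSum]
    · exact fun i _ => (hLc _).intervalIntegrable _ _
    · exact (continuous_const.mul (continuous_finsetSum _ fun i _ => hLc _)).intervalIntegrable _ _
    · exact (hCc x).intervalIntegrable _ _
  have hcons : lam * ∑ j, ‖y j‖ ^ 2 ≤
      ∑ i, ∫ s in (t - T)..t, (fun j => y j i) ⬝ᵥ (L s *ᵥ fun j => y j i) := by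
    simp only [EuclideanSpace.norm_sq_eq]
    rw [Finset.sum_comm, Finset.mul_sum]
    exact Finset.sum_le_sum fun i _ => by simpa using hconn t ht (fun j => y j i) (hysum i)
  have hCnn : 0 ≤ ∫ s in (t - T)..t, ∑ j, ⟪c j s, x j⟫ ^ 2 :=
    integral_nonneg hle fun s _ => by positivity
  have hmean : a * ‖m‖ ^ 2 ≤ 2 * (∫ s in (t - T)..t, ∑ j, ⟪c j s, x j⟫ ^ 2) +
      T * (2 * r₂ * ∑ j, ‖y j‖ ^ 2) := by
    calc a * ‖m‖ ^ 2 ≤ ∫ s in (t - T)..t, ∑ j, ⟪c j s, m⟫ ^ 2 := hPE t ht m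
      _ ≤ ∫ s in (t - T)..t, (2 * (∑ j, ⟪c j s, x j⟫ ^ 2) + 2 * r₂ * ∑ j, ‖y j‖ ^ 2) := by
        refine integral_mono_on hle ((hCc fun _ => m).intervalIntegrable _ _)
          (((hCc x).const_mul 2).add continuous_const |>.intervalIntegrable _ _) fun s hs => ?_
        rw [Finset.mul_sum, Finset.mul_sum, ← Finset.sum_add_distrib]
        refine Finset.sum_le_sum fun j _ => ?_
        have h1 : ⟪c j s, y j⟫ = ⟪c j s, x j⟫ - ⟪c j s, m⟫ := inner_sub_right _ _ _
        have h2 : ⟪c j s, y j⟫ ^ 2 ≤ r₂ * ‖y j‖ ^ 2 := by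
          calc ⟪c j s, y j⟫ ^ 2 = |⟪c j s, y j⟫| ^ 2 := (sq_abs _).symm
            _ ≤ (‖c j s‖ * ‖y j‖) ^ 2 := by
              gcongr
              exact abs_real_inner_le_norm _ _
            _ = ‖c j s‖ ^ 2 * ‖y j‖ ^ 2 := mul_pow _ _ _
            _ ≤ r₂ * ‖y j‖ ^ 2 := by
              gcongr
              exact hcbd j s (by linarith [hs.1])
        rw [h1] at h2
        nlinarith [sq_nonneg (2 * ⟪c j s, x j⟫ - ⟪c j s, m⟫)]
      _ = _ := by
        rw [integral_add ((hCc x).const_mul 2 |>.intervalIntegrable _ _) (by simp),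
          intervalIntegral.integral_const_mul]
        simp only [intervalIntegral.integral_const, sub_sub_cancel, smul_eq_mul]
  have hnorm : ‖x‖ ^ 2 ≤ 2 * N * ‖m‖ ^ 2 + 2 * ∑ j, ‖y j‖ ^ 2 := by
    rw [PiLp.norm_sq_eq_of_L2]
    have : ∀ j, ‖x j‖ ^ 2 ≤ 2 * ‖m‖ ^ 2 + 2 * ‖y j‖ ^ 2 := by
      intro j
      have h := parallelogram_law_with_norm ℝ m (y j)
      have hx : m + y j = x j := by simp [hy]
      rw [hx] at h
      nlinarith [mul_self_nonneg ‖m - y j‖]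
    refine (Finset.sum_le_sum fun j _ => this j).trans (le_of_eq ?_)
    rw [Finset.sum_add_distrib, Finset.mul_sum _ _ (2 : ℝ)]
    simp only [Finset.sum_const, Finset.card_univ, nsmul_eq_mul, ← hN]
    ring
  have hY : ∑ j, ‖y j‖ ^ 2 ≤ I / (α * lam) := by
    rw [le_div_iff₀ (by positivity)]
    nlinarith [mul_le_mul_of_nonneg_left hcons hα.le]
  have hCI : ∫ s in (t - T)..t, ∑ j, ⟪c j s, x j⟫ ^ 2 ≤ I := by
    have : 0 ≤ lam * ∑ j, ‖y j‖ ^ 2 := by positivity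
    have := mul_nonneg hα.le (this.trans hcons)
    linarith
  have hm2 : ‖m‖ ^ 2 ≤ (2 + 2 * r₂ * T / (α * lam)) / a * I := by
    rw [div_mul_eq_mul_div, le_div_iff₀ ha]
    have h1 : T * (2 * r₂ * ∑ j, ‖y j‖ ^ 2) ≤ T * (2 * r₂ * (I / (α * lam))) := by gcongr
    calc ‖m‖ ^ 2 * a ≤ 2 * I + T * (2 * r₂ * (I / (α * lam))) := by linarith
      _ = _ := by ring
  rw [inv_mul_le_iff₀ hKpos]
  calc ‖x‖ ^ 2 ≤ 2 * N * ((2 + 2 * r₂ * T / (α * lam)) / a * I) + 2 * (I / (α * lam)) := by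
        refine hnorm.trans ?_
        gcongr
    _ = K * I := by rw [hK]; ring

/-- Under the standing assumptions, along any C+I estimator trajectory,
every control area's local total-inertia estimate
`Ĥ_j^tot(t) = (ω_s/2) Σ_i 1/(θ̂_j(t))_i` converges to the true total inertia
`H^tot = Σ_i H_i`, where `H_i = ω_s/(2θ_i)` and `θ_i > 0` for all `i`. -/
theorem stmt_8
    (n : ℕ) (hn : 1 ≤ n)
    (α r₁ r₂ r₃ T ιlo ιhi lam ωs : ℝ)
    (hα : 0 < α) (hr₁ : 0 < r₁) (hr₂ : 0 < r₂) (hr₃ : 0 < r₃)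
    (hT : 0 < T) (hιlo : 0 < ιlo) (hιord : ιlo ≤ ιhi) (hlam : 0 < lam)
    (hωs : 0 < ωs)
    (Γ : Fin n → (EuclideanSpace ℝ (Fin n) →L[ℝ] EuclideanSpace ℝ (Fin n)))
    (c : Fin n → ℝ → EuclideanSpace ℝ (Fin n))
    (L : ℝ → Matrix (Fin n) (Fin n) ℝ)
    (θ : EuclideanSpace ℝ (Fin n))
    -- the true parameters are positive: θ_i = ω_s/(2H_i) with H_i := ω_s/(2θ_i) > 0
    (hθpos : ∀ i, 0 < θ i)
    -- gains: symmetric, positive definite, bounded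
    (hΓsymm : ∀ j, ∀ v w, ⟪Γ j v, w⟫ = ⟪v, Γ j w⟫)
    (hΓpos : ∀ j, ∀ v, v ≠ 0 → 0 < ⟪v, Γ j v⟫)
    (hΓbd : ∀ j, ‖Γ j‖ ≤ r₁)
    -- regressors: continuous and bounded
    (hccont : ∀ j, Continuous (c j))
    (hcbd : ∀ j, ∀ t ≥ (0 : ℝ), ‖c j t‖ ^ 2 ≤ r₂)
    -- Laplacians: continuous, symmetric, positive semidefinite, L 𝟙 = 0, bounded
    (hLcont : Continuous L)
    (hLsymm : ∀ t, (L t).IsSymm)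
    (hLpsd : ∀ t, (L t).PosSemidef)
    (hL1 : ∀ t, (L t) *ᵥ (fun _ => (1 : ℝ)) = 0)
    (hLbd : ∀ t ≥ (0 : ℝ), ‖Matrix.toEuclideanCLM (𝕜 := ℝ) (L t)‖ ≤ r₃)
    -- cooperative persistency of excitation
    (hPE : ∀ t ≥ T, ∀ v : EuclideanSpace ℝ (Fin n),
      ιlo * ‖v‖ ^ 2 ≤ (∫ s in (t - T)..t, ∑ j, ⟪c j s, v⟫ ^ 2) ∧
        (∫ s in (t - T)..t, ∑ j, ⟪c j s, v⟫ ^ 2) ≤ ιhi * ‖v‖ ^ 2)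
    -- connectivity on average
    (hconn : ∀ t ≥ T, ∀ v : Fin n → ℝ, (∑ j, v j) = 0 →
      lam * (∑ j, v j ^ 2) ≤ ∫ s in (t - T)..t, v ⬝ᵥ ((L s) *ᵥ v)) :
    ∀ θhat : Fin n → ℝ → EuclideanSpace ℝ (Fin n),
      -- C+I update with y_j(t) = c_j(t)ᵀ θ
      (∀ j, ∀ t ≥ (0 : ℝ), HasDerivWithinAt (θhat j)
        (-(α • Γ j (∑ k, L t j k • θhat k t))
          - Γ j ((⟪c j t, θhat j t⟫ - ⟪c j t, θ⟫) • c j t)) (Ici 0) t) →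
      -- each area's local total-inertia estimate converges to H^tot = Σ_i ω_s/(2θ_i)
      ∀ j, Tendsto (fun t => ωs / 2 * ∑ i, 1 / θhat j t i) atTop
        (nhds (∑ i, ωs / (2 * θ i))) := by
  intro θhat hode j
  have : Nonempty (Fin n) := ⟨⟨0, hn⟩⟩
  obtain ⟨μ, hμ, hexc⟩ := exists_pos_le_integral_consensusInnovation hα hr₂.le hT.le hιlo hlam
    hLcont hccont hcbd hLsymm hL1 (fun t ht v => (hPE t ht v).1) hconn
  have hform : ∀ t x y, ⟪consensusInnovation α (L t) (fun j => c j t) x, y⟫ =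
      ⟪x, consensusInnovation α (L t) (fun j => c j t) y⟫ := fun t x y => by
    rw [real_inner_comm, inner_consensusInnovation, inner_consensusInnovation]
    congr 1
    · congr 1
      refine Finset.sum_congr rfl fun i _ => ?_
      rw [Matrix.dotProduct_mulVec, ← Matrix.mulVec_transpose, (hLsymm t).eq, dotProduct_comm]
    · exact Finset.sum_congr rfl fun j _ => mul_comm _ _
  set e : ℝ → PiLp 2 (fun _ : Fin n => EuclideanSpace ℝ (Fin n)) :=
    fun t => WithLp.toLp 2 fun j => θhat j t - θ with he
  have hrow : ∀ t j, ∑ k, L t j k = 0 := fun t j => by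
    simpa [Matrix.mulVec, dotProduct] using congrFun (hL1 t) j
  have hlim : Tendsto e atTop (nhds 0) := by
    refine tendsto_zero_of_persistently_excited_flow (G := blockDiagCLM Γ)
      (A := fun t => consensusInnovation α (L t) fun j => c j t) (r := r₁)
      (M := 2 * α * r₃ + 2 * r₂) (by positivity) hT hμ ?_ ?_ (norm_blockDiagCLM_le hr₁.le hΓbd)
      (continuous_consensusInnovation hLcont hccont) hform ?_ ?_ hexc ?_
    · intro v w
      simp [PiLp.inner_apply (𝕜 := ℝ) (f := fun _ : Fin n => EuclideanSpace ℝ (Fin n)),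
        blockDiagCLM_apply, hΓsymm]
    · intro v hv
      rw [PiLp.inner_apply]
      have hnn : ∀ j, 0 ≤ ⟪v j, Γ j (v j)⟫ := fun j => by
        rcases eq_or_ne (v j) 0 with h | h
        · simp [h]
        · exact (hΓpos j _ h).le
      obtain ⟨j, hj⟩ : ∃ j, v j ≠ 0 := by
        by_contra! h
        exact hv (PiLp.ext h)
      exact Finset.sum_pos' (fun j _ => hnn j) ⟨j, Finset.mem_univ _, hΓpos j _ hj⟩
    · intro t v
      rw [inner_consensusInnovation]
      have h1 : ∀ i, 0 ≤ (fun j => v j i) ⬝ᵥ (L t *ᵥ fun j => v j i) := fun i => by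
        simpa using (hLpsd t).dotProduct_mulVec_nonneg fun j => v j i
      exact add_nonneg (mul_nonneg hα.le (Finset.sum_nonneg fun i _ => h1 i))
        (Finset.sum_nonneg fun j _ => mul_self_nonneg _)
    · exact fun t ht v => norm_sq_consensusInnovation_le hα.le hr₃ (hLpsd t) (hLbd t ht)
        (fun j => hcbd j t ht) hr₂.le v
    · intro t ht
      have hd := hasDerivWithinAt_pi.2 fun j => (hode j t ht).sub_const θ
      refine ((PiLp.hasFDerivAt_toLp 2 _).comp_hasDerivWithinAt t hd).congr_deriv ?_
      ext1 j
      change _ = (-blockDiagCLM Γ (consensusInnovation α (L t) (fun j => c j t) (e t))) j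
      rw [PiLp.neg_apply, blockDiagCLM_apply, consensusInnovation_apply]
      have hsum : ∑ k, L t j k • e t k = ∑ k, L t j k • θhat k t := by
        simp [he, smul_sub, Finset.sum_sub_distrib, ← Finset.sum_smul, hrow]
      have hej : ⟪c j t, e t j⟫ = ⟪c j t, θhat j t⟫ - ⟪c j t, θ⟫ := inner_sub_right _ _ _
      rw [hsum, hej, map_add, map_smul, neg_add, ← sub_eq_add_neg]
      rfl
  have hcoord : ∀ i, Tendsto (fun t => θhat j t i) atTop (nhds (θ i)) := by
    intro i
    have h1 : Tendsto (fun t => e t j i + θ i) atTop (nhds (0 + θ i)) := by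
      refine Tendsto.add_const _ ?_
      have hc : Continuous fun x : PiLp 2 (fun _ : Fin n => EuclideanSpace ℝ (Fin n)) => x j i := by
        fun_prop
      exact (hc.tendsto 0).comp hlim
    simpa [he] using h1
  have hval : ∑ i, ωs / (2 * θ i) = ωs / 2 * ∑ i, 1 / θ i := by
    rw [Finset.mul_sum]
    exact Finset.sum_congr rfl fun i _ => by rw [div_mul_div_comm, mul_one]
  rw [hval]
  exact (tendsto_finsetSum _ fun i _ =>
    tendsto_const_nhds.div (hcoord i) (hθpos i).ne').const_mul _
end
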